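/- arXiv:2202.02066 — 3 statements merged into one kernel-verified Lean document; each statement's English description precedes it below -/
import Mathlib

section
/- Let μ = ℙ∘Π^{-1} be a measure on a parabolic carpet with ℙ weakly quasi-Bernoulli, and suppose the projection L^q-spectra t_f(q), t_g(q) and t(i,q) exist for all finite words i. Fix q ≥ 0 and s ∈ ℝ, and let Φ^{s,q}(i) := ℙ([i])^q α₁(i)^{t(i,q)} α₂(i)^{s−t(i,q)} be any singular value function with α̲₁(i) ≤ α₁(i) ≤ ᾱ₁(i) and α̲₂(i) ≤ α₂(i) ≤ ᾱ₂(i). Then there exists an increasing sequence of positive numbers (C_n) with C_n^{1/n} → 1 such that for any words i_1 ∈ I^{n_1}, …, i_k ∈ I^{n_k}: (i) if s < t_f(q)+t_g(q) then Φ^{s,q}(i_1⋯i_k) ≤ C_{n_1}⋯C_{n_k} Φ^{s,q}(i_1)⋯Φ^{s,q}(i_k); (ii) if s = t_f(q)+t_g(q) then C_{n_1}^{-1}⋯C_{n_k}^{-1} Φ^{s,q}(i_1)⋯Φ^{s,q}(i_k) ≤ Φ^{s,q}(i_1⋯i_k) ≤ C_{n_1}⋯C_{n_k} Φ^{s,q}(i_1)⋯Φ^{s,q}(i_k);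 (iii) if s > t_f(q)+t_g(q) then Φ^{s,q}(i_1⋯i_k) ≥ C_{n_1}^{-1}⋯C_{n_k}^{-1} Φ^{s,q}(i_1)⋯Φ^{s,q}(i_k). -/
open Set Filter MeasureTheory Metric Topology
open scoped ENNReal NNReal

/-- Composition of the maps along a finite word: `h_{i₁…iₙ} = h_{i₁} ∘ ⋯ ∘ h_{iₙ}`. -/
def wMap {I : Type} (h : I → ℝ → ℝ) : List I → ℝ → ℝ
  | [] => id
  | a :: t => h a ∘ wMap h t

/-- Derivative cocycle of the composition along a finite word (chain rule). -/
def wDeriv {I : Type} (h h' : I → ℝ → ℝ) : List I → ℝ → ℝ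
  | [] => fun _ => 1
  | a :: t => fun x => h' a (wMap h t x) * wDeriv h h' t x

/-- `‖h_w'‖_∞`, the sup of `|h_w'|` over `[0,1]`. -/
noncomputable def supD {I : Type} (h h' : I → ℝ → ℝ) (w : List I) : ℝ :=
  ⨆ x : Icc (0:ℝ) 1, |wDeriv h h' w x|

/-- The cylinder of infinite words beginning with the finite word `w`. -/
def cyl {I : Type} (w : List I) : Set (ℕ → I) := {ω | ∀ k : Fin w.length, ω k = w.get k}

/-- A parabolic IFS on `[0,1]` satisfying A1', A2', A3' (parabolic Cantor set system). -/
structure PCantorIFS (I : Type) [Fintype I] where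
  h : I → ℝ → ℝ
  h' : I → ℝ → ℝ
  αh : ℝ
  αh_pos : 0 < αh
  card : 2 ≤ Fintype.card I
  maps : ∀ i, MapsTo (h i) (Icc (0:ℝ) 1) (Icc (0:ℝ) 1)
  contract : ∀ i, ∀ x ∈ Icc (0:ℝ) 1, ∀ y ∈ Icc (0:ℝ) 1, x ≠ y → |h i x - h i y| < |x - y|
  hasDeriv : ∀ i, ∀ x ∈ Icc (0:ℝ) 1, HasDerivWithinAt (h i) (h' i x) (Icc (0:ℝ) 1) x
  holder : ∃ C > 0, ∀ i, ∀ x ∈ Icc (0:ℝ) 1, ∀ y ∈ Icc (0:ℝ) 1,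
      |h' i x - h' i y| ≤ C * |x - y| ^ αh
  nonzero : ∀ i, ∀ x ∈ Icc (0:ℝ) 1, h' i x ≠ 0
  sep : ∀ i j, i ≠ j → Disjoint (h i '' Ioo (0:ℝ) 1) (h j '' Ioo (0:ℝ) 1)

/-- The induced (hyperbolic) alphabet `I_∞ = {j i₀ : j ∈ (I ∖ {i₀})^*} ∪ {i₀}`. -/
def Iinf {I : Type} (i0 : I) : Set (List I) :=
  {w | ∃ j : List I, (∀ a ∈ j, a ≠ i0) ∧ w = j ++ [i0]}

/-- Finite concatenations of words from `I_∞`. -/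
def IinfStar {I : Type} (i0 : I) : Set (List I) :=
  {w | ∃ L : List (List I), (∀ u ∈ L, u ∈ Iinf i0) ∧ w = L.flatten}

/-- The truncated induced alphabet `I_N`. -/
def IN {I : Type} (i0 : I) (N : ℕ) : Set (List I) :=
  {w | w ∈ Iinf i0 ∧ w.length ≤ N}

/-- The weak quasi-Bernoulli property. -/
def WeakQB {I : Type} [MeasurableSpace I] (P : Measure (ℕ → I)) : Prop :=
  ∃ c : ℕ → ℝ, (∀ n, 0 < c n) ∧
    Tendsto (fun n : ℕ => c n ^ ((n : ℝ)⁻¹)) atTop (𝓝 1) ∧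
    ∀ L : List (List I), (∀ w ∈ L, w ≠ []) →
      ((L.map fun w => c w.length).prod)⁻¹ * (L.map fun w => (P (cyl w)).toReal).prod
          ≤ (P (cyl L.flatten)).toReal ∧
        (P (cyl L.flatten)).toReal
          ≤ (L.map fun w => c w.length).prod * (L.map fun w => (P (cyl w)).toReal).prod

/-- The quasi-Bernoulli property restricted to concatenations of words from `I_∞`. -/
def QBonInf {I : Type} [MeasurableSpace I] (P : Measure (ℕ → I)) (i0 : I) : Prop :=
  ∃ c : ℝ, 1 ≤ c ∧ ∀ u ∈ IinfStar i0, ∀ v ∈ IinfStar i0,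
    c⁻¹ * ((P (cyl u)).toReal * (P (cyl v)).toReal) ≤ (P (cyl (u ++ v))).toReal ∧
    (P (cyl (u ++ v))).toReal ≤ c * ((P (cyl u)).toReal * (P (cyl v)).toReal)

/-- The partition sums `∑_{i ∈ I^n} ℙ([i])^q ‖h_i'‖_∞^s` over the full alphabet. -/
noncomputable def pSum {I : Type} [Fintype I] [MeasurableSpace I]
    (P : Measure (ℕ → I)) (h h' : I → ℝ → ℝ) (n : ℕ) (s q : ℝ) : ℝ :=
  ∑ w : Fin n → I, (P (cyl (List.ofFn w))).toReal ^ q * supD h h' (List.ofFn w) ^ s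

/-- The partition sums over `n`-fold concatenations of words from an alphabet `J` of
finite words. -/
noncomputable def zSum {I : Type} [MeasurableSpace I]
    (P : Measure (ℕ → I)) (h h' : I → ℝ → ℝ) (J : Set (List I)) (n : ℕ) (s q : ℝ) : ℝ :=
  ∑' w : Fin n → ↥J,
    (P (cyl (List.flatten (List.ofFn fun k => ((w k : List I)))))).toReal ^ q *
      supD h h' (List.flatten (List.ofFn fun k => ((w k : List I)))) ^ s

/-- `x ^ q` with the convention `0^0 = 0` used for moment sums. -/
noncomputable def pw (a q : ℝ) : ℝ := if a = 0 then 0 else a ^ q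

/-- The `q`-th moment sum of a measure on `ℝ` over the closed intervals of the `δ`-mesh. -/
noncomputable def Dq1 (ν : Measure ℝ) (q δ : ℝ) : ℝ :=
  ∑' k : ℤ, pw ((ν (Icc ((k : ℝ) * δ) (((k : ℝ) + 1) * δ))).toReal) q

/-- Number of intervals of the `δ`-mesh which intersect `F ⊆ ℝ`. -/
noncomputable def covCount (F : Set ℝ) (δ : ℝ) : ℕ :=
  Set.ncard {k : ℤ | (Icc ((k : ℝ) * δ) (((k : ℝ) + 1) * δ) ∩ F).Nonempty}
/-- A parabolic carpet IFS on `[0,1]²` satisfying A1, A2, A3. -/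
structure PCarpetIFS (I : Type) [Fintype I] where
  f : I → ℝ → ℝ
  g : I → ℝ → ℝ
  f' : I → ℝ → ℝ
  g' : I → ℝ → ℝ
  αf : ℝ
  αg : ℝ
  αf_pos : 0 < αf
  αg_pos : 0 < αg
  card : 2 ≤ Fintype.card I
  mapsf : ∀ i, MapsTo (f i) (Icc (0:ℝ) 1) (Icc (0:ℝ) 1)
  mapsg : ∀ i, MapsTo (g i) (Icc (0:ℝ) 1) (Icc (0:ℝ) 1)
  contractf : ∀ i, ∀ x ∈ Icc (0:ℝ) 1, ∀ y ∈ Icc (0:ℝ) 1, x ≠ y → |f i x - f i y| < |x - y|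
  contractg : ∀ i, ∀ x ∈ Icc (0:ℝ) 1, ∀ y ∈ Icc (0:ℝ) 1, x ≠ y → |g i x - g i y| < |x - y|
  hasDerivf : ∀ i, ∀ x ∈ Icc (0:ℝ) 1, HasDerivWithinAt (f i) (f' i x) (Icc (0:ℝ) 1) x
  hasDerivg : ∀ i, ∀ x ∈ Icc (0:ℝ) 1, HasDerivWithinAt (g i) (g' i x) (Icc (0:ℝ) 1) x
  holderf : ∃ C > 0, ∀ i, ∀ x ∈ Icc (0:ℝ) 1, ∀ y ∈ Icc (0:ℝ) 1,
      |f' i x - f' i y| ≤ C * |x - y| ^ αf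
  holderg : ∃ C > 0, ∀ i, ∀ x ∈ Icc (0:ℝ) 1, ∀ y ∈ Icc (0:ℝ) 1,
      |g' i x - g' i y| ≤ C * |x - y| ^ αg
  nonzerof : ∀ i, ∀ x ∈ Icc (0:ℝ) 1, f' i x ≠ 0
  nonzerog : ∀ i, ∀ x ∈ Icc (0:ℝ) 1, g' i x ≠ 0
  gridf : ∀ i j, ¬ Disjoint (f i '' Ioo (0:ℝ) 1) (f j '' Ioo (0:ℝ) 1) → f i = f j
  gridg : ∀ i j, ¬ Disjoint (g i '' Ioo (0:ℝ) 1) (g j '' Ioo (0:ℝ) 1) → g i = g j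
  osc : ∀ i j, ¬ Disjoint (f i '' Ioo (0:ℝ) 1) (f j '' Ioo (0:ℝ) 1) →
      ¬ Disjoint (g i '' Ioo (0:ℝ) 1) (g j '' Ioo (0:ℝ) 1) → i = j

variable {I : Type} [Fintype I]

/-- The carpet map `S_w` on `[0,1]²` associated with a finite word `w`. -/
def SMap (S : PCarpetIFS I) (w : List I) : ℝ × ℝ → ℝ × ℝ :=
  fun p => (wMap S.f w p.1, wMap S.g w p.2)

/-- `ᾱ₁(w) = max_x max{|f_w'(x)|, |g_w'(x)|}`. -/
noncomputable def a1U (S : PCarpetIFS I) (w : List I) : ℝ :=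
  ⨆ x : Icc (0:ℝ) 1, max |wDeriv S.f S.f' w x| |wDeriv S.g S.g' w x|

/-- `ᾱ₂(w) = max_x min{|f_w'(x)|, |g_w'(x)|}`. -/
noncomputable def a2U (S : PCarpetIFS I) (w : List I) : ℝ :=
  ⨆ x : Icc (0:ℝ) 1, min |wDeriv S.f S.f' w x| |wDeriv S.g S.g' w x|

/-- `α̲₁(w) = min_x max{|f_w'(x)|, |g_w'(x)|}`. -/
noncomputable def a1L (S : PCarpetIFS I) (w : List I) : ℝ :=
  ⨅ x : Icc (0:ℝ) 1, max |wDeriv S.f S.f' w x| |wDeriv S.g S.g' w x|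

/-- `α̲₂(w) = min_x min{|f_w'(x)|, |g_w'(x)|}`. -/
noncomputable def a2L (S : PCarpetIFS I) (w : List I) : ℝ :=
  ⨅ x : Icc (0:ℝ) 1, min |wDeriv S.f S.f' w x| |wDeriv S.g S.g' w x|

/-- `t(w, q)`: the `L^q`-spectrum of the projection of `μ` onto the coordinate axis in the
direction of the longer side of `S_w([0,1]²)`; `tf` and `tg` are the spectra of the
projections to the `x`- and `y`-axis respectively. -/
noncomputable def tSel (S : PCarpetIFS I) (tf tg : ℝ → ℝ) (w : List I) (q : ℝ) : ℝ :=
  if Metric.diam (wMap S.g w '' Icc (0:ℝ) 1) ≤ Metric.diam (wMap S.f w '' Icc (0:ℝ) 1)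
    then tf q else tg q

/-- The partition sums for the carpet pressure,
`∑_{i ∈ I^n} ℙ([i])^q ᾱ₁(i)^{t(i,q)} ᾱ₂(i)^{s - t(i,q)}`. -/
noncomputable def cSum [MeasurableSpace I] (P : Measure (ℕ → I)) (S : PCarpetIFS I)
    (tf tg : ℝ → ℝ) (n : ℕ) (s q : ℝ) : ℝ :=
  ∑ w : Fin n → I,
    (P (cyl (List.ofFn w))).toReal ^ q *
      a1U S (List.ofFn w) ^ tSel S tf tg (List.ofFn w) q *
        a2U S (List.ofFn w) ^ (s - tSel S tf tg (List.ofFn w) q)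

/-- The `q`-th moment sum of a measure on `ℝ²` over the closed squares of the `δ`-mesh. -/
noncomputable def Dq2 (ν : Measure (ℝ × ℝ)) (q δ : ℝ) : ℝ :=
  ∑' k : ℤ × ℤ,
    pw ((ν (Icc ((k.1 : ℝ) * δ) (((k.1 : ℝ) + 1) * δ) ×ˢ
        Icc ((k.2 : ℝ) * δ) (((k.2 : ℝ) + 1) * δ))).toReal) q

/-- Number of squares of the `δ`-mesh which intersect `F ⊆ ℝ²`. -/
noncomputable def covCount2 (F : Set (ℝ × ℝ)) (δ : ℝ) : ℕ :=
  Set.ncard {k : ℤ × ℤ |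
    ((Icc ((k.1 : ℝ) * δ) (((k.1 : ℝ) + 1) * δ) ×ˢ
      Icc ((k.2 : ℝ) * δ) (((k.2 : ℝ) + 1) * δ)) ∩ F).Nonempty}

/-- The upper box dimension of a subset of `ℝ²` (via mesh squares). -/
noncomputable def ubDim2 (E : Set (ℝ × ℝ)) : ℝ :=
  Filter.limsup (fun δ : ℝ => Real.log (covCount2 E δ) / (-Real.log δ)) (𝓝[>] (0:ℝ))

/-- The packing dimension of a subset of `ℝ²`, defined (as usual, via the identification of
packing dimension with the modified upper box dimension) as the infimum over countable covers
by bounded sets of the supremal upper box dimension of the pieces. -/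
noncomputable def dimP2 (F : Set (ℝ × ℝ)) : ℝ :=
  sInf {a : ℝ | ∃ E : ℕ → Set (ℝ × ℝ), F ⊆ ⋃ n, E n ∧
    ∀ n, Bornology.IsBounded (E n) ∧ ubDim2 (E n) ≤ a}

/-- A singular value function `Φ^{s,q}(w) = ℙ([w])^q α₁(w)^{t(w,q)} α₂(w)^{s - t(w,q)}`. -/
noncomputable def svf {I : Type} [Fintype I] [MeasurableSpace I] (P : Measure (ℕ → I))
    (S : PCarpetIFS I) (tf tg : ℝ → ℝ) (a1 a2 : List I → ℝ) (s q : ℝ) (w : List I) : ℝ :=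
  (P (cyl w)).toReal ^ q * a1 w ^ tSel S tf tg w q * a2 w ^ (s - tSel S tf tg w q)

/-- A finite family of strict contractions of `[0,1]` contracts uniformly at scales above `ε`. -/
lemma exists_uniform_contraction {I : Type} [Fintype I] {h : I → ℝ → ℝ}
    (hc : ∀ i, ∀ x ∈ Icc (0:ℝ) 1, ∀ y ∈ Icc (0:ℝ) 1, x ≠ y → |h i x - h i y| < |x - y|)
    {ε : ℝ} (hε : 0 < ε) :
    ∃ κ : ℝ, 0 ≤ κ ∧ κ < 1 ∧ ∀ i, ∀ x ∈ Icc (0:ℝ) 1, ∀ y ∈ Icc (0:ℝ) 1, ε ≤ |x - y| →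
      |h i x - h i y| ≤ κ * |x - y| := by
  have hcont : ∀ i, ContinuousOn (h i) (Icc 0 1) := fun i => by
    refine LipschitzOnWith.continuousOn (K := 1) (LipschitzOnWith.of_dist_le_mul fun x hx y hy => ?_)
    rw [Real.dist_eq, Real.dist_eq, NNReal.coe_one, one_mul]
    rcases eq_or_ne x y with rfl | hne
    · simp
    · exact (hc i x hx y hy hne).le
  set K : Set (ℝ × ℝ) := (Icc (0:ℝ) 1 ×ˢ Icc (0:ℝ) 1) ∩ {p | ε ≤ |p.1 - p.2|} with hK
  have hKc : IsCompact K :=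
    (isCompact_Icc.prod isCompact_Icc).inter_right (isClosed_le continuous_const (by fun_prop))
  have key : ∀ i, ∃ κ : ℝ, 0 ≤ κ ∧ κ < 1 ∧ ∀ p ∈ K,
      |h i p.1 - h i p.2| ≤ κ * |p.1 - p.2| := by
    intro i
    rcases K.eq_empty_or_nonempty with hE | hne
    · exact ⟨0, le_rfl, one_pos, by simp [hE]⟩
    have hcq : ContinuousOn (fun p : ℝ × ℝ => |h i p.1 - h i p.2| / |p.1 - p.2|) K := by
      refine ContinuousOn.div ?_ (by fun_prop) fun p hp => (hε.trans_le hp.2).ne'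
      exact (((hcont i).comp continuousOn_fst fun p hp => hp.1.1).sub
        ((hcont i).comp continuousOn_snd fun p hp => hp.1.2)).abs
    obtain ⟨p, hp, hmax⟩ := hKc.exists_isMaxOn hne hcq
    have hpos : ∀ p ∈ K, 0 < |p.1 - p.2| := fun p hp => hε.trans_le hp.2
    refine ⟨|h i p.1 - h i p.2| / |p.1 - p.2|, by positivity, ?_, fun r hr => ?_⟩
    · rw [div_lt_one (hpos p hp)]
      refine hc i _ hp.1.1 _ hp.1.2 fun heq => ?_
      have := hpos p hp
      simp [heq] at this
    · have := hmax hr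
      simp only [Set.mem_ofPred_eq] at this
      rwa [div_le_iff₀ (hpos r hr)] at this
  choose κ h0 h1 hκ using key
  rcases isEmpty_or_nonempty I with _ | _
  · exact ⟨0, le_rfl, one_pos, fun i => isEmptyElim i⟩
  obtain ⟨j, hj⟩ := Finite.exists_max κ
  refine ⟨κ j, h0 j, h1 j, fun i x hx y hy hxy => ?_⟩
  exact (hκ i (x, y) ⟨⟨hx, hy⟩, hxy⟩).trans (mul_le_mul_of_nonneg_right (hj i) (abs_nonneg _))

lemma wMap_mem {I : Type} {h : I → ℝ → ℝ}
    (hm : ∀ i, MapsTo (h i) (Icc (0:ℝ) 1) (Icc (0:ℝ) 1)) (w : List I) {x : ℝ}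
    (hx : x ∈ Icc (0:ℝ) 1) : wMap h w x ∈ Icc (0:ℝ) 1 := by
  induction w with
  | nil => exact hx
  | cons a t ih => exact hm a ih

lemma wMap_append {I : Type} (h : I → ℝ → ℝ) (u v : List I) (x : ℝ) :
    wMap h (u ++ v) x = wMap h u (wMap h v x) := by
  induction u with
  | nil => rfl
  | cons a t ih => simp [wMap, ih]

lemma wDeriv_append {I : Type} (h h' : I → ℝ → ℝ) (u v : List I) (x : ℝ) :
    wDeriv h h' (u ++ v) x = wDeriv h h' u (wMap h v x) * wDeriv h h' v x := by
  induction u with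
  | nil => simp [wDeriv]
  | cons a t ih => simp [wDeriv, ih, wMap_append, mul_assoc]

lemma wDeriv_ne_zero {I : Type} {h h' : I → ℝ → ℝ}
    (hm : ∀ i, MapsTo (h i) (Icc (0:ℝ) 1) (Icc (0:ℝ) 1))
    (hn : ∀ i, ∀ x ∈ Icc (0:ℝ) 1, h' i x ≠ 0) (w : List I) {x : ℝ}
    (hx : x ∈ Icc (0:ℝ) 1) : wDeriv h h' w x ≠ 0 := by
  induction w with
  | nil => exact one_ne_zero
  | cons a t ih => exact mul_ne_zero (hn a _ (wMap_mem hm t hx)) ih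

lemma hasDerivWithinAt_wMap {I : Type} {h h' : I → ℝ → ℝ}
    (hm : ∀ i, MapsTo (h i) (Icc (0:ℝ) 1) (Icc (0:ℝ) 1))
    (hd : ∀ i, ∀ x ∈ Icc (0:ℝ) 1, HasDerivWithinAt (h i) (h' i x) (Icc (0:ℝ) 1) x)
    (w : List I) {x : ℝ} (hx : x ∈ Icc (0:ℝ) 1) :
    HasDerivWithinAt (wMap h w) (wDeriv h h' w x) (Icc (0:ℝ) 1) x := by
  induction w with
  | nil => exact hasDerivWithinAt_id x _
  | cons a t ih =>
    exact (hd a _ (wMap_mem hm t hx)).comp x ih fun y hy => wMap_mem hm t hy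

/-- Cylinder images shrink uniformly to points. -/
lemma exists_wMap_dist_le {I : Type} [Fintype I] {h : I → ℝ → ℝ}
    (hm : ∀ i, MapsTo (h i) (Icc (0:ℝ) 1) (Icc (0:ℝ) 1))
    (hc : ∀ i, ∀ x ∈ Icc (0:ℝ) 1, ∀ y ∈ Icc (0:ℝ) 1, x ≠ y → |h i x - h i y| < |x - y|)
    {ε : ℝ} (hε : 0 < ε) :
    ∃ N : ℕ, ∀ w : List I, N ≤ w.length → ∀ x ∈ Icc (0:ℝ) 1, ∀ y ∈ Icc (0:ℝ) 1,
      |wMap h w x - wMap h w y| ≤ ε := by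
  obtain ⟨κ, h0, h1, hκ⟩ := exists_uniform_contraction hc hε
  have key : ∀ w : List I, ∀ x ∈ Icc (0:ℝ) 1, ∀ y ∈ Icc (0:ℝ) 1,
      |wMap h w x - wMap h w y| ≤ max ε (κ ^ w.length) := by
    intro w x hx y hy
    induction w with
    | nil =>
      refine le_max_of_le_right ?_
      simp only [wMap, id, List.length_nil, pow_zero]
      rw [abs_le]
      constructor <;> linarith [hx.1, hx.2, hy.1, hy.2]
    | cons a t ih =>
      have hx' := wMap_mem hm t hx
      have hy' := wMap_mem hm t hy
      simp only [wMap, Function.comp_apply, List.length_cons]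
      rcases le_or_gt ε |wMap h t x - wMap h t y| with hl | hl
      · have h3 := hκ a _ hx' _ hy' hl
        rcases le_max_iff.1 ih with h4 | h4
        · refine le_max_of_le_left (h3.trans ?_)
          nlinarith [abs_nonneg (wMap h t x - wMap h t y)]
        · refine le_max_of_le_right (h3.trans ?_)
          rw [pow_succ']
          exact mul_le_mul_of_nonneg_left h4 h0
      · refine le_max_of_le_left ?_
        rcases eq_or_ne (wMap h t x) (wMap h t y) with he | hne
        · simp [he, hε.le]
        · exact ((hc a _ hx' _ hy' hne).trans hl).le
  obtain ⟨N, hN⟩ := exists_pow_lt_of_lt_one hε h1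
  refine ⟨N, fun w hw x hx y hy => (key w x hx y hy).trans (max_le le_rfl ?_)⟩
  exact (pow_le_pow_of_le_one h0 h1.le hw).trans hN.le

/-- Distortion of compositions grows subexponentially in the length of the word. -/
lemma exists_distortion {I : Type} [Fintype I] {h h' : I → ℝ → ℝ}
    (hm : ∀ i, MapsTo (h i) (Icc (0:ℝ) 1) (Icc (0:ℝ) 1))
    (hc : ∀ i, ∀ x ∈ Icc (0:ℝ) 1, ∀ y ∈ Icc (0:ℝ) 1, x ≠ y → |h i x - h i y| < |x - y|)
    (hcont : ∀ i, ContinuousOn (h' i) (Icc (0:ℝ) 1))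
    (hn : ∀ i, ∀ x ∈ Icc (0:ℝ) 1, h' i x ≠ 0) :
    ∃ E : ℕ → ℝ, (∀ n, 0 ≤ E n) ∧ Monotone E ∧
      Tendsto (fun n : ℕ => E n / n) atTop (𝓝 0) ∧
      ∀ w : List I, ∀ x ∈ Icc (0:ℝ) 1, ∀ y ∈ Icc (0:ℝ) 1,
        |Real.log |wDeriv h h' w x| - Real.log (|wDeriv h h' w y|)| ≤ E w.length := by
  set ψ : I → ℝ → ℝ := fun i x => Real.log |h' i x| with hψ
  have hψc : ∀ i, ContinuousOn (ψ i) (Icc 0 1) := fun i =>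
    (hcont i).abs.log fun x hx => abs_ne_zero.2 (hn i x hx)
  have hψu : ∀ η : ℝ, 0 < η → ∃ δ : ℝ, 0 < δ ∧ ∀ i, ∀ x ∈ Icc (0:ℝ) 1, ∀ y ∈ Icc (0:ℝ) 1,
      |x - y| ≤ δ → |ψ i x - ψ i y| ≤ η := by
    intro η hη
    have := fun i => Metric.uniformContinuousOn_iff_le.1
      (isCompact_Icc.uniformContinuousOn_of_continuous (hψc i)) η hη
    choose δ hδ hδ' using this
    rcases isEmpty_or_nonempty I with _ | _
    · exact ⟨1, one_pos, fun i => isEmptyElim i⟩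
    obtain ⟨j, hj⟩ := Finite.exists_min δ
    exact ⟨δ j, hδ j, fun i x hx y hy hxy => hδ' i x hx y hy (hxy.trans (hj i))⟩
  have hψb : ∃ B : ℝ, ∀ i, ∀ x ∈ Icc (0:ℝ) 1, |ψ i x| ≤ B := by
    have := fun i => isCompact_Icc.exists_bound_of_continuousOn (hψc i)
    choose B hB using this
    obtain ⟨M, hM⟩ := (Set.finite_range B).bddAbove
    exact ⟨M, fun i x hx => (hB i x hx).trans (hM ⟨i, rfl⟩)⟩
  obtain ⟨B, hB⟩ := hψb
  set T : ℕ → Set ℝ := fun k => {r | ∃ w : List I, w.length = k ∧ ∃ i, ∃ x ∈ Icc (0:ℝ) 1,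
    ∃ y ∈ Icc (0:ℝ) 1, r = |ψ i (wMap h w x) - ψ i (wMap h w y)|} with hT
  have hTb : ∀ k, BddAbove (T k) := fun k => ⟨B + B, by
    rintro r ⟨w, -, i, x, hx, y, hy, rfl⟩
    exact (abs_sub _ _).trans (add_le_add (hB i _ (wMap_mem hm w hx)) (hB i _ (wMap_mem hm w hy)))⟩
  have he0 : ∀ k, 0 ≤ sSup (T k) := fun k => Real.sSup_nonneg (by
    rintro r ⟨w, -, i, x, hx, y, hy, rfl⟩
    exact abs_nonneg _)
  have het : Tendsto (fun k => sSup (T k)) atTop (𝓝 0) := by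
    rw [Metric.tendsto_atTop]
    intro η hη
    obtain ⟨δ, hδ, hδ'⟩ := hψu (η / 2) (half_pos hη)
    obtain ⟨N, hN⟩ := exists_wMap_dist_le hm hc hδ
    refine ⟨N, fun k hk => ?_⟩
    rw [Real.dist_eq, sub_zero, abs_of_nonneg (he0 k)]
    refine (Real.sSup_le ?_ (half_pos hη).le).trans_lt (half_lt_self hη)
    rintro r ⟨w, rfl, i, x, hx, y, hy, rfl⟩
    exact hδ' i _ (wMap_mem hm w hx) _ (wMap_mem hm w hy) (hN w hk x hx y hy)
  refine ⟨fun n => ∑ k ∈ Finset.range n, sSup (T k), fun n => Finset.sum_nonneg fun k _ => he0 k,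
    fun a b hab => Finset.sum_le_sum_of_subset_of_nonneg (Finset.range_mono hab)
      fun k _ _ => he0 k, ?_, ?_⟩
  · simpa [div_eq_inv_mul] using het.cesaro
  · intro w x hx y hy
    beta_reduce
    induction w with
    | nil => simp [wDeriv]
    | cons a t ih =>
      have hlog : ∀ z ∈ Icc (0:ℝ) 1, Real.log |wDeriv h h' (a :: t) z|
          = ψ a (wMap h t z) + Real.log |wDeriv h h' t z| := fun z hz => by
        simp only [wDeriv, hψ, abs_mul]
        exact Real.log_mul (abs_ne_zero.2 (hn a _ (wMap_mem hm t hz)))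
          (abs_ne_zero.2 (wDeriv_ne_zero hm hn t hz))
      have h1 : |ψ a (wMap h t x) - ψ a (wMap h t y)| ≤ sSup (T t.length) :=
        le_csSup (hTb _) ⟨t, rfl, a, x, hx, y, hy, rfl⟩
      rw [hlog x hx, hlog y hy, List.length_cons, Finset.sum_range_succ]
      rw [abs_le] at h1 ih ⊢
      constructor <;> linarith [h1.1, h1.2, ih.1, ih.2]

/-- The diameter of the image of `[0,1]` is comparable to the derivative. -/
lemma diam_wMap_mem {I : Type} {h h' : I → ℝ → ℝ}
    (hm : ∀ i, MapsTo (h i) (Icc (0:ℝ) 1) (Icc (0:ℝ) 1))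
    (hd : ∀ i, ∀ x ∈ Icc (0:ℝ) 1, HasDerivWithinAt (h i) (h' i x) (Icc (0:ℝ) 1) x)
    (w : List I) {m M : ℝ}
    (hb : ∀ x ∈ Icc (0:ℝ) 1, m ≤ |wDeriv h h' w x| ∧ |wDeriv h h' w x| ≤ M) :
    m ≤ Metric.diam (wMap h w '' Icc (0:ℝ) 1) ∧ Metric.diam (wMap h w '' Icc (0:ℝ) 1) ≤ M := by
  have hD := fun x (hx : x ∈ Icc (0:ℝ) 1) => hasDerivWithinAt_wMap hm hd w hx
  have hcw : ContinuousOn (wMap h w) (Icc 0 1) := fun x hx => (hD x hx).continuousWithinAt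
  have h0 : (0:ℝ) ∈ Icc (0:ℝ) 1 := by simp
  have h1 : (1:ℝ) ∈ Icc (0:ℝ) 1 := by simp
  constructor
  · obtain ⟨c, hc, hc'⟩ := exists_hasDerivAt_eq_slope (wMap h w) (wDeriv h h' w) one_pos hcw
      fun x hx => (hD x (Ioo_subset_Icc_self hx)).hasDerivAt (Icc_mem_nhds hx.1 hx.2)
    have h2 : dist (wMap h w 1) (wMap h w 0) ≤ Metric.diam (wMap h w '' Icc (0:ℝ) 1) :=
      Metric.dist_le_diam_of_mem (isCompact_Icc.image_of_continuousOn hcw).isBounded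
        (mem_image_of_mem _ h1) (mem_image_of_mem _ h0)
    refine le_trans ?_ h2
    have h3 := (hb c (Ioo_subset_Icc_self hc)).1
    rw [hc'] at h3
    simpa [Real.dist_eq] using h3
  · have hM : 0 ≤ M := (abs_nonneg _).trans (hb 0 h0).2
    refine Metric.diam_le_of_forall_dist_le hM ?_
    rintro _ ⟨x, hx, rfl⟩ _ ⟨y, hy, rfl⟩
    have h2 := (convex_Icc (0:ℝ) 1).norm_image_sub_le_of_norm_hasDerivWithin_le hD
      (fun z hz => (hb z hz).2) hy hx
    rw [dist_eq_norm]
    refine h2.trans (mul_le_of_le_one_right hM ?_)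
    rw [Real.norm_eq_abs, abs_le]
    constructor <;> linarith [hx.1, hx.2, hy.1, hy.2]

lemma abs_log_sub_le_iff {z a r : ℝ} (hz : 0 < z) :
    |Real.log z - a| ≤ r ↔ Real.exp (a - r) ≤ z ∧ z ≤ Real.exp (a + r) := by
  rw [abs_le, ← Real.le_log_iff_exp_le hz, ← Real.log_le_iff_le_exp hz]
  constructor <;> rintro ⟨h1, h2⟩ <;> constructor <;> linarith

/-- `log` of the diameter of the image of `[0,1]` under the composition along `w`. -/
noncomputable def logDiam {I : Type} (h : I → ℝ → ℝ) (w : List I) : ℝ :=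
  Real.log (Metric.diam (wMap h w '' Icc (0:ℝ) 1))

lemma abs_logDiam_sub_le {I : Type} {h h' : I → ℝ → ℝ}
    (hm : ∀ i, MapsTo (h i) (Icc (0:ℝ) 1) (Icc (0:ℝ) 1))
    (hd : ∀ i, ∀ x ∈ Icc (0:ℝ) 1, HasDerivWithinAt (h i) (h' i x) (Icc (0:ℝ) 1) x)
    (hn : ∀ i, ∀ x ∈ Icc (0:ℝ) 1, h' i x ≠ 0)
    (w : List I) {a r : ℝ}
    (hb : ∀ x ∈ Icc (0:ℝ) 1, |Real.log |wDeriv h h' w x| - a| ≤ r) :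
    0 < Metric.diam (wMap h w '' Icc (0:ℝ) 1) ∧ |logDiam h w - a| ≤ r := by
  obtain ⟨h1, h2⟩ := diam_wMap_mem hm hd w fun x hx =>
    (abs_log_sub_le_iff (abs_pos.2 (wDeriv_ne_zero hm hn w hx))).1 (hb x hx)
  have hpos := (Real.exp_pos _).trans_le h1
  exact ⟨hpos, (abs_log_sub_le_iff hpos).2 ⟨h1, h2⟩⟩

/-- If each word's derivative is within `e w` of `φ w` on the logarithmic scale, then the
derivative along a concatenation is within the summed errors of the summed values. -/
lemma abs_log_wDeriv_flatten_sub_le {I : Type} {h h' : I → ℝ → ℝ}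
    (hm : ∀ i, MapsTo (h i) (Icc (0:ℝ) 1) (Icc (0:ℝ) 1))
    (hn : ∀ i, ∀ x ∈ Icc (0:ℝ) 1, h' i x ≠ 0) {φ e : List I → ℝ}
    (hφ : ∀ w, ∀ x ∈ Icc (0:ℝ) 1, |Real.log |wDeriv h h' w x| - φ w| ≤ e w)
    (L : List (List I)) :
    ∀ x ∈ Icc (0:ℝ) 1,
      |Real.log |wDeriv h h' L.flatten x| - (L.map φ).sum| ≤ (L.map e).sum := by
  intro x hx
  induction L with
  | nil => simp [wDeriv]
  | cons u L ih =>
    have hx' := wMap_mem hm L.flatten hx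
    have h1 := hφ u _ hx'
    rw [List.flatten_cons, wDeriv_append, abs_mul,
      Real.log_mul (abs_ne_zero.2 (wDeriv_ne_zero hm hn u hx'))
        (abs_ne_zero.2 (wDeriv_ne_zero hm hn _ hx)), List.map_cons, List.map_cons,
      List.sum_cons, List.sum_cons]
    rw [abs_le] at h1 ih ⊢
    constructor <;> linarith [h1.1, h1.2, ih.1, ih.2]

lemma continuousOn_of_abs_sub_le_rpow {k : ℝ → ℝ} {s : Set ℝ} {C α : ℝ} (hα : 0 < α)
    (hk : ∀ x ∈ s, ∀ y ∈ s, |k x - k y| ≤ C * |x - y| ^ α) : ContinuousOn k s := by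
  intro x hx
  have h1 : Tendsto (fun y => C * |y - x| ^ α) (𝓝[s] x) (𝓝 0) := by
    have : Continuous fun y : ℝ => C * |y - x| ^ α :=
      continuous_const.mul ((by fun_prop : Continuous fun y : ℝ => |y - x|).rpow_const
        fun _ => Or.inr hα.le)
    have h2 := (this.tendsto x).mono_left (nhdsWithin_le_nhds (s := s))
    simpa [Real.zero_rpow hα.ne'] using h2
  refine tendsto_iff_dist_tendsto_zero.2 (squeeze_zero' (Eventually.of_forall fun _ => dist_nonneg)
    ?_ h1)
  filter_upwards [self_mem_nhdsWithin] with y hy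
  exact hk y hy x hx

/-- A sequence `ℓ n = o(n)` is dominated by a monotone nonnegative sequence that is `o(n)`. -/
lemma exists_monotone_majorant {l : ℕ → ℝ} (hl : Tendsto (fun n : ℕ => l n / n) atTop (𝓝 0)) :
    ∃ u : ℕ → ℝ, (∀ n, 0 ≤ u n) ∧ Monotone u ∧ (∀ n, l n ≤ u n) ∧
      Tendsto (fun n : ℕ => u n / n) atTop (𝓝 0) := by
  set v : ℕ → ℝ := fun n => max (l n) 0
  have hu0 : ∀ n, 0 ≤ partialSups v n := fun n =>
    (le_max_right (l n) 0).trans (le_partialSups v n)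
  refine ⟨fun n => partialSups v n, hu0, (partialSups v).monotone,
    fun n => (le_max_left _ _).trans (le_partialSups v n), ?_⟩
  rw [Metric.tendsto_atTop] at hl ⊢
  intro ε hε
  obtain ⟨N, hN⟩ := hl (ε / 2) (half_pos hε)
  obtain ⟨M, hM⟩ := exists_nat_gt (partialSups v N / (ε / 2))
  refine ⟨max M (N + 1), fun n hn => ?_⟩
  have hnM : (M : ℝ) ≤ n := by exact_mod_cast (le_max_left _ _).trans hn
  have hn1 : 1 ≤ n := by have := (le_max_right M (N + 1)).trans hn; omega
  have hnpos : (0:ℝ) < n := by exact_mod_cast hn1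
  have hle : partialSups v n ≤ ε / 2 * n := by
    refine partialSups_le v n _ fun k hk => ?_
    rcases le_or_gt k N with hkN | hkN
    · refine (le_partialSups_of_le v hkN).trans ?_
      rw [div_lt_iff₀ (half_pos hε)] at hM
      nlinarith
    · have hkpos : (0:ℝ) < k := by exact_mod_cast (Nat.zero_le N).trans_lt hkN
      have h1 := hN k hkN.le
      rw [Real.dist_eq, sub_zero, abs_lt, div_lt_iff₀ hkpos] at h1
      have hkn : (k:ℝ) ≤ n := by exact_mod_cast hk
      refine max_le ?_ (by positivity)
      nlinarith [h1.2]
  rw [Real.dist_eq, sub_zero, abs_of_nonneg (div_nonneg (hu0 n) hnpos.le), div_lt_iff₀ hnpos]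
  nlinarith

lemma List.prod_map_exp {α : Type*} (L : List α) (f : α → ℝ) :
    (L.map fun w => Real.exp (f w)).prod = Real.exp (L.map f).sum := by
  induction L with
  | nil => simp
  | cons a L ih => simp [ih, Real.exp_add]

/-- Weak quasi-Bernoulli with monotone constants, on the exponential scale. -/
lemma WeakQB.exists_exp_bound {I : Type} [MeasurableSpace I] {P : Measure (ℕ → I)}
    (hP : WeakQB P) :
    ∃ u : ℕ → ℝ, (∀ n, 0 ≤ u n) ∧ Monotone u ∧ Tendsto (fun n : ℕ => u n / n) atTop (𝓝 0) ∧
      ∀ L : List (List I), (∀ w ∈ L, w ≠ []) →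
        Real.exp (-(L.map fun w => u w.length).sum) * (L.map fun w => (P (cyl w)).toReal).prod
            ≤ (P (cyl L.flatten)).toReal ∧
          (P (cyl L.flatten)).toReal
            ≤ Real.exp (L.map fun w => u w.length).sum
              * (L.map fun w => (P (cyl w)).toReal).prod := by
  obtain ⟨c, hc, hct, hcP⟩ := hP
  have hl : Tendsto (fun n : ℕ => Real.log (c n) / n) atTop (𝓝 0) := by
    have := hct.log one_ne_zero
    simpa [Real.log_rpow (hc _), div_eq_inv_mul] using this
  obtain ⟨u, hu0, hum, hul, hut⟩ := exists_monotone_majorant hl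
  refine ⟨u, hu0, hum, hut, fun L hL => ?_⟩
  obtain ⟨h1, h2⟩ := hcP L hL
  have hprod : (0:ℝ) ≤ (L.map fun w => (P (cyl w)).toReal).prod :=
    List.prod_nonneg (by simp)
  have hc1 : (L.map fun w => c w.length).prod
      = Real.exp (L.map fun w => Real.log (c w.length)).sum := by
    rw [← List.prod_map_exp]
    simp [Real.exp_log (hc _)]
  have hle : (L.map fun w => Real.log (c w.length)).sum ≤ (L.map fun w => u w.length).sum :=
    List.sum_le_sum fun w _ => hul _
  rw [hc1] at h1 h2
  constructor
  · refine le_trans (mul_le_mul_of_nonneg_right ?_ hprod) h1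
    rw [← Real.exp_neg]
    exact Real.exp_le_exp.2 (neg_le_neg hle)
  · exact h2.trans (mul_le_mul_of_nonneg_right (Real.exp_le_exp.2 hle) hprod)

lemma List.prod_map_rpow_of_nonneg {α : Type*} (L : List α) {f : α → ℝ} (hf : ∀ a, 0 ≤ f a)
    (q : ℝ) : (L.map fun w => f w ^ q).prod = (L.map f).prod ^ q := by
  induction L with
  | nil => simp
  | cons a L ih =>
    have : 0 ≤ (L.map f).prod := List.prod_nonneg (by simpa using fun a _ => hf a)
    simp [ih, Real.mul_rpow (hf a) this]

/-- `log (α₁(w)^t α₂(w)^{s-t})`. -/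
noncomputable def logSvf {I : Type} [Fintype I] (S : PCarpetIFS I) (tf tg : ℝ → ℝ)
    (a1 a2 : List I → ℝ) (s q : ℝ) (w : List I) : ℝ :=
  tSel S tf tg w q * Real.log (a1 w) + (s - tSel S tf tg w q) * Real.log (a2 w)

lemma abs_linear_comb_sub_le {t d x y a b r : ℝ} (hx : |x - a| ≤ r) (hy : |y - b| ≤ r) :
    |(t * x + d * y) - (t * a + d * b)| ≤ (|t| + |d|) * r := by
  have : (t * x + d * y) - (t * a + d * b) = t * (x - a) + d * (y - b) := by ring
  rw [this]
  refine (abs_add_le _ _).trans ?_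
  rw [abs_mul, abs_mul, add_mul]
  gcongr

section Comparison

variable {S : PCarpetIFS I} {a1 a2 : List I → ℝ} {w : List I} {a b r : ℝ}

lemma abs_log_a1_sub_le (ha1 : a1L S w ≤ a1 w ∧ a1 w ≤ a1U S w)
    (hf : ∀ x ∈ Icc (0:ℝ) 1, |Real.log |wDeriv S.f S.f' w x| - a| ≤ r)
    (hg : ∀ x ∈ Icc (0:ℝ) 1, |Real.log |wDeriv S.g S.g' w x| - b| ≤ r) :
    0 < a1 w ∧ |Real.log (a1 w) - max a b| ≤ r := by
  have hne : Nonempty (Icc (0:ℝ) 1) := ⟨⟨0, by simp⟩⟩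
  have hF := fun x (hx : x ∈ Icc (0:ℝ) 1) => (abs_log_sub_le_iff
    (abs_pos.2 (wDeriv_ne_zero S.mapsf S.nonzerof w hx))).1 (hf x hx)
  have hG := fun x (hx : x ∈ Icc (0:ℝ) 1) => (abs_log_sub_le_iff
    (abs_pos.2 (wDeriv_ne_zero S.mapsg S.nonzerog w hx))).1 (hg x hx)
  have h1 : Real.exp (max a b - r) ≤ a1 w := by
    refine le_trans (le_ciInf fun x => ?_) ha1.1
    rcases le_total a b with h | h
    · rw [max_eq_right h]
      exact le_max_of_le_right (hG x x.2).1
    · rw [max_eq_left h]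
      exact le_max_of_le_left (hF x x.2).1
  have h2 : a1 w ≤ Real.exp (max a b + r) := by
    refine ha1.2.trans (ciSup_le fun x => max_le ((hF x x.2).2.trans ?_) ((hG x x.2).2.trans ?_))
    · gcongr; exact le_max_left _ _
    · gcongr; exact le_max_right _ _
  have hpos := (Real.exp_pos _).trans_le h1
  exact ⟨hpos, (abs_log_sub_le_iff hpos).2 ⟨h1, h2⟩⟩

lemma abs_log_a2_sub_le (ha2 : a2L S w ≤ a2 w ∧ a2 w ≤ a2U S w)
    (hf : ∀ x ∈ Icc (0:ℝ) 1, |Real.log |wDeriv S.f S.f' w x| - a| ≤ r)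
    (hg : ∀ x ∈ Icc (0:ℝ) 1, |Real.log |wDeriv S.g S.g' w x| - b| ≤ r) :
    0 < a2 w ∧ |Real.log (a2 w) - min a b| ≤ r := by
  have hne : Nonempty (Icc (0:ℝ) 1) := ⟨⟨0, by simp⟩⟩
  have hF := fun x (hx : x ∈ Icc (0:ℝ) 1) => (abs_log_sub_le_iff
    (abs_pos.2 (wDeriv_ne_zero S.mapsf S.nonzerof w hx))).1 (hf x hx)
  have hG := fun x (hx : x ∈ Icc (0:ℝ) 1) => (abs_log_sub_le_iff
    (abs_pos.2 (wDeriv_ne_zero S.mapsg S.nonzerog w hx))).1 (hg x hx)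
  have h1 : Real.exp (min a b - r) ≤ a2 w := by
    refine le_trans (le_ciInf fun x : Icc (0:ℝ) 1 => le_min (le_trans ?_ (hF x x.2).1)
      (le_trans ?_ (hG x x.2).1)) ha2.1
    · gcongr; exact min_le_left _ _
    · gcongr; exact min_le_right _ _
  have h2 : a2 w ≤ Real.exp (min a b + r) := by
    refine ha2.2.trans (ciSup_le fun x => ?_)
    rcases le_total a b with h | h
    · rw [min_eq_left h]
      exact min_le_of_left_le (hF _ x.2).2
    · rw [min_eq_right h]
      exact min_le_of_right_le (hG x x.2).2
  have hpos := (Real.exp_pos _).trans_le h1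
  exact ⟨hpos, (abs_log_sub_le_iff hpos).2 ⟨h1, h2⟩⟩

/-- On the logarithmic scale the singular value function is, up to the distortion, the linear form
in the logarithmic side lengths selected by the longer side. -/
lemma abs_logSvf_sub_le (tf tg : ℝ → ℝ) (s q : ℝ)
    (ha1 : a1L S w ≤ a1 w ∧ a1 w ≤ a1U S w) (ha2 : a2L S w ≤ a2 w ∧ a2 w ≤ a2U S w)
    (hf : ∀ x ∈ Icc (0:ℝ) 1, |Real.log |wDeriv S.f S.f' w x| - a| ≤ r)
    (hg : ∀ x ∈ Icc (0:ℝ) 1, |Real.log |wDeriv S.g S.g' w x| - b| ≤ r) :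
    (logDiam S.g w ≤ logDiam S.f w ∧
      |logSvf S tf tg a1 a2 s q w - (tf q * a + (s - tf q) * b)|
        ≤ (|tf q| + |s - tf q| + (|tg q| + |s - tg q|)) * (3 * r)) ∨
    (logDiam S.f w ≤ logDiam S.g w ∧
      |logSvf S tf tg a1 a2 s q w - (tg q * b + (s - tg q) * a)|
        ≤ (|tf q| + |s - tf q| + (|tg q| + |s - tg q|)) * (3 * r)) := by
  obtain ⟨hF, hφ⟩ := abs_logDiam_sub_le S.mapsf S.hasDerivf S.nonzerof w hf
  obtain ⟨hG, hγ⟩ := abs_logDiam_sub_le S.mapsg S.hasDerivg S.nonzerog w hg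
  obtain ⟨-, h1⟩ := abs_log_a1_sub_le ha1 hf hg
  obtain ⟨-, h2⟩ := abs_log_a2_sub_le ha2 hf hg
  have hr : 0 ≤ r := (abs_nonneg _).trans h1
  rw [abs_le] at hφ hγ h1 h2
  by_cases hc : Metric.diam (wMap S.g w '' Icc (0:ℝ) 1) ≤ Metric.diam (wMap S.f w '' Icc (0:ℝ) 1)
  · have hd : logDiam S.g w ≤ logDiam S.f w := Real.log_le_log hG hc
    have h3 : |Real.log (a1 w) - a| ≤ 3 * r := by
      rw [abs_le]; constructor <;> cases max_cases a b <;> linarith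
    have h4 : |Real.log (a2 w) - b| ≤ 3 * r := by
      rw [abs_le]; constructor <;> cases min_cases a b <;> linarith
    refine Or.inl ⟨hd, ?_⟩
    simp only [logSvf, tSel, if_pos hc]
    refine (abs_linear_comb_sub_le h3 h4).trans (mul_le_mul_of_nonneg_right ?_ (by positivity))
    exact le_add_of_nonneg_right (by positivity)
  · have hd : logDiam S.f w ≤ logDiam S.g w := Real.log_le_log hF (not_le.1 hc).le
    have h3 : |Real.log (a1 w) - b| ≤ 3 * r := by
      rw [abs_le]; constructor <;> cases max_cases a b <;> linarith
    have h4 : |Real.log (a2 w) - a| ≤ 3 * r := by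
      rw [abs_le]; constructor <;> cases min_cases a b <;> linarith
    refine Or.inr ⟨hd, ?_⟩
    simp only [logSvf, tSel, if_neg hc]
    refine (abs_linear_comb_sub_le h3 h4).trans (mul_le_mul_of_nonneg_right ?_ (by positivity))
    exact le_add_of_nonneg_left (by positivity)

end Comparison

lemma svf_eq_mul_exp_logSvf {I : Type} [Fintype I] [MeasurableSpace I] (P : Measure (ℕ → I))
    (S : PCarpetIFS I) (tf tg : ℝ → ℝ) {a1 a2 : List I → ℝ} (s q : ℝ) {w : List I}
    (h1 : 0 < a1 w) (h2 : 0 < a2 w) :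
    svf P S tf tg a1 a2 s q w = (P (cyl w)).toReal ^ q * Real.exp (logSvf S tf tg a1 a2 s q w) := by
  rw [svf, logSvf, Real.exp_add, Real.rpow_def_of_pos h1, Real.rpow_def_of_pos h2, mul_assoc]
  simp only [mul_comm]

lemma List.sum_map_linear_le {α : Type*} {φ γ Λ e : α → ℝ} {x y : ℝ} (L : List α)
    (h : ∀ w, x * φ w + y * γ w ≤ Λ w + e w) :
    x * (L.map φ).sum + y * (L.map γ).sum ≤ (L.map Λ).sum + (L.map e).sum := by
  induction L with
  | nil => simp
  | cons a L ih =>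
    simp only [List.map_cons, List.sum_cons]
    linarith [h a]

/-- Almost additivity of `logSvf` with subexponential error. -/
lemma exists_logSvf_bound {I : Type} [Fintype I] (S : PCarpetIFS I) (tf tg : ℝ → ℝ)
    {a1 a2 : List I → ℝ} (s q : ℝ)
    (ha1 : ∀ w : List I, a1L S w ≤ a1 w ∧ a1 w ≤ a1U S w)
    (ha2 : ∀ w : List I, a2L S w ≤ a2 w ∧ a2 w ≤ a2U S w) :
    (∀ w, 0 < a1 w ∧ 0 < a2 w) ∧
    ∃ e : ℕ → ℝ, Monotone e ∧ Tendsto (fun n : ℕ => e n / n) atTop (𝓝 0) ∧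
      ∀ L : List (List I),
        (s ≤ tf q + tg q → logSvf S tf tg a1 a2 s q L.flatten
          ≤ (L.map fun w => e w.length).sum + (L.map (logSvf S tf tg a1 a2 s q)).sum) ∧
        (tf q + tg q ≤ s → -(L.map fun w => e w.length).sum
          + (L.map (logSvf S tf tg a1 a2 s q)).sum ≤ logSvf S tf tg a1 a2 s q L.flatten) := by
  obtain ⟨Cf, -, hCf⟩ := S.holderf
  obtain ⟨Cg, -, hCg⟩ := S.holderg
  obtain ⟨Ef, hf0, hfm, hft, hfE⟩ := exists_distortion S.mapsf S.contractf
    (fun i => continuousOn_of_abs_sub_le_rpow S.αf_pos (hCf i)) S.nonzerof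
  obtain ⟨Eg, hg0, hgm, hgt, hgE⟩ := exists_distortion S.mapsg S.contractg
    (fun i => continuousOn_of_abs_sub_le_rpow S.αg_pos (hCg i)) S.nonzerog
  set E : ℕ → ℝ := fun n => Ef n + Eg n with hE
  have hφ : ∀ w : List I, ∀ x ∈ Icc (0:ℝ) 1,
      |Real.log |wDeriv S.f S.f' w x| - logDiam S.f w| ≤ E w.length := fun w x hx => by
    have := (abs_logDiam_sub_le S.mapsf S.hasDerivf S.nonzerof w fun y hy => hfE w y hy x hx).2
    rw [abs_sub_comm]
    exact this.trans (le_add_of_nonneg_right (hg0 _))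
  have hγ : ∀ w : List I, ∀ x ∈ Icc (0:ℝ) 1,
      |Real.log |wDeriv S.g S.g' w x| - logDiam S.g w| ≤ E w.length := fun w x hx => by
    have := (abs_logDiam_sub_le S.mapsg S.hasDerivg S.nonzerog w fun y hy => hgE w y hy x hx).2
    rw [abs_sub_comm]
    exact this.trans (le_add_of_nonneg_left (hf0 _))
  refine ⟨fun w => ⟨(abs_log_a1_sub_le (ha1 w) (hφ w) (hγ w)).1,
    (abs_log_a2_sub_le (ha2 w) (hφ w) (hγ w)).1⟩, ?_⟩
  set K : ℝ := |tf q| + |s - tf q| + (|tg q| + |s - tg q|) with hK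
  have hK0 : 0 ≤ K := by positivity
  refine ⟨fun n => 6 * K * E n, (hfm.add hgm).const_mul (by positivity), ?_, fun L => ?_⟩
  · have := (hft.add hgt).const_mul (6 * K)
    simp only [add_zero, mul_zero] at this
    refine this.congr fun n => ?_
    simp only [hE]
    ring
  have hsum : ∀ c : ℝ, (L.map fun w => c * E w.length).sum = c * (L.map fun w => E w.length).sum :=
    fun c => List.sum_map_mul_left L (fun w => E w.length) c
  have hflat := abs_logSvf_sub_le tf tg s q (ha1 L.flatten) (ha2 L.flatten)
    (abs_log_wDeriv_flatten_sub_le S.mapsf S.nonzerof hφ L)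
    (abs_log_wDeriv_flatten_sub_le S.mapsg S.nonzerog hγ L)
  have hone := fun w => abs_logSvf_sub_le tf tg s q (ha1 w) (ha2 w) (hφ w) (hγ w)
  rw [← hK] at hflat
  simp only [← hK, abs_le] at hone hflat
  rw [hsum]
  constructor <;> intro hs
  · have hA := List.sum_map_linear_le (x := tf q) (y := s - tf q) (φ := logDiam S.f)
      (γ := logDiam S.g) (Λ := logSvf S tf tg a1 a2 s q) (e := fun w => 3 * K * E w.length) L
      fun w => by rcases hone w with ⟨h1, h2, h3⟩ | ⟨h1, h2, h3⟩ <;> nlinarith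
    have hB := List.sum_map_linear_le (x := s - tg q) (y := tg q) (φ := logDiam S.f)
      (γ := logDiam S.g) (Λ := logSvf S tf tg a1 a2 s q) (e := fun w => 3 * K * E w.length) L
      fun w => by rcases hone w with ⟨h1, h2, h3⟩ | ⟨h1, h2, h3⟩ <;> nlinarith
    rw [hsum] at hA hB
    rcases hflat with ⟨-, h2, h3⟩ | ⟨-, h2, h3⟩ <;> linarith
  · have hneg : (L.map fun w => -logSvf S tf tg a1 a2 s q w).sum
        = -(L.map (logSvf S tf tg a1 a2 s q)).sum := by
      simpa using List.sum_map_mul_left L (logSvf S tf tg a1 a2 s q) (-1)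
    have hA := List.sum_map_linear_le (x := -tf q) (y := -(s - tf q)) (φ := logDiam S.f)
      (γ := logDiam S.g) (Λ := fun w => -logSvf S tf tg a1 a2 s q w)
      (e := fun w => 3 * K * E w.length) L
      fun w => by rcases hone w with ⟨h1, h2, h3⟩ | ⟨h1, h2, h3⟩ <;> nlinarith
    have hB := List.sum_map_linear_le (x := -(s - tg q)) (y := -tg q) (φ := logDiam S.f)
      (γ := logDiam S.g) (Λ := fun w => -logSvf S tf tg a1 a2 s q w)
      (e := fun w => 3 * K * E w.length) L
      fun w => by rcases hone w with ⟨h1, h2, h3⟩ | ⟨h1, h2, h3⟩ <;> nlinarith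
    rw [hsum, hneg] at hA hB
    rcases hflat with ⟨-, h2, h3⟩ | ⟨-, h2, h3⟩ <;> linarith

/-- Almost sub/super-multiplicativity of singular value functions on a
parabolic carpet: for a weakly quasi-Bernoulli `ℙ` there is an increasing sequence of
positive constants `Cₙ` with `Cₙ^{1/n} → 1` governing the multiplicativity defect of
`Φ^{s,q}` according to the sign of `s - (t_f(q) + t_g(q))`. -/
theorem singular_value_function_multiplicativity {I : Type} [Fintype I] [MeasurableSpace I]
    [MeasurableSingletonClass I]
    (S : PCarpetIFS I)
    (P : Measure (ℕ → I)) [IsProbabilityMeasure P]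
    (hwqb : WeakQB P)
    (Pi : (ℕ → I) → ℝ × ℝ)
    (hPi : ∀ ω : ℕ → I,
      (⋂ n : ℕ, SMap S (List.ofFn fun k : Fin n => ω k) '' (Icc (0:ℝ) 1 ×ˢ Icc (0:ℝ) 1))
        = {Pi ω})
    (hPiM : Measurable Pi)
    (tf tg : ℝ → ℝ)
    (htf : ∀ q : ℝ, 0 ≤ q →
      Tendsto (fun δ : ℝ => Real.log (Dq1 (P.map fun ω => (Pi ω).1) q δ) / (-Real.log δ))
        (𝓝[>] (0:ℝ)) (𝓝 (tf q)))
    (htg : ∀ q : ℝ, 0 ≤ q →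
      Tendsto (fun δ : ℝ => Real.log (Dq1 (P.map fun ω => (Pi ω).2) q δ) / (-Real.log δ))
        (𝓝[>] (0:ℝ)) (𝓝 (tg q)))
    (q : ℝ) (hq : 0 ≤ q) (s : ℝ)
    (a1 a2 : List I → ℝ)
    (ha1 : ∀ w : List I, a1L S w ≤ a1 w ∧ a1 w ≤ a1U S w)
    (ha2 : ∀ w : List I, a2L S w ≤ a2 w ∧ a2 w ≤ a2U S w) :
    ∃ C : ℕ → ℝ, (∀ n, 0 < C n) ∧ Monotone C ∧
      Tendsto (fun n : ℕ => C n ^ ((n : ℝ)⁻¹)) atTop (𝓝 1) ∧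
      ∀ L : List (List I), (∀ w ∈ L, w ≠ []) →
        (s < tf q + tg q →
          svf P S tf tg a1 a2 s q L.flatten
            ≤ (L.map fun w => C w.length).prod * (L.map (svf P S tf tg a1 a2 s q)).prod) ∧
        (s = tf q + tg q →
          ((L.map fun w => C w.length).prod)⁻¹ * (L.map (svf P S tf tg a1 a2 s q)).prod
              ≤ svf P S tf tg a1 a2 s q L.flatten ∧
            svf P S tf tg a1 a2 s q L.flatten
              ≤ (L.map fun w => C w.length).prod * (L.map (svf P S tf tg a1 a2 s q)).prod) ∧
        (tf q + tg q < s →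
          ((L.map fun w => C w.length).prod)⁻¹ * (L.map (svf P S tf tg a1 a2 s q)).prod
            ≤ svf P S tf tg a1 a2 s q L.flatten) := by
  obtain ⟨hpos, e, hem, het, heL⟩ := exists_logSvf_bound S tf tg s q ha1 ha2
  obtain ⟨u, -, hum, hut, huL⟩ := hwqb.exists_exp_bound
  refine ⟨fun n => Real.exp (q * u n + e n), fun n => Real.exp_pos _,
    Real.exp_monotone.comp ((hum.const_mul hq).add hem), ?_, fun L hL => ?_⟩
  · have h1 := ((hut.const_mul q).add het).rexp
    simp only [mul_zero, add_zero, Real.exp_zero] at h1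
    refine h1.congr fun n => ?_
    rw [← Real.exp_mul]
    congr 1
    ring
  have hsvf := fun w => svf_eq_mul_exp_logSvf P S tf tg s q (hpos w).1 (hpos w).2
  set p : List I → ℝ := fun w => (P (cyl w)).toReal with hp
  have hp0 : ∀ w, 0 ≤ p w := fun w => ENNReal.toReal_nonneg
  have hprod0 : 0 ≤ (L.map p).prod := List.prod_nonneg (by simpa using fun w _ => hp0 w)
  set U := (L.map fun w => u w.length).sum with hU
  set M := (L.map fun w => e w.length).sum with hM
  have hC : (L.map fun w => Real.exp (q * u w.length + e w.length)).prod
      = Real.exp (q * U + M) := by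
    rw [List.prod_map_exp, List.sum_map_add, List.sum_map_mul_left]
  have hR : (L.map (svf P S tf tg a1 a2 s q)).prod
      = (L.map p).prod ^ q * Real.exp (L.map (logSvf S tf tg a1 a2 s q)).sum := by
    rw [← List.prod_map_rpow_of_nonneg L hp0, ← List.prod_map_exp, ← List.prod_map_mul]
    exact congrArg List.prod (List.map_congr_left fun w _ => hsvf w)
  obtain ⟨hP1, hP2⟩ := huL L hL
  have hPq : p L.flatten ^ q ≤ Real.exp (q * U) * (L.map p).prod ^ q := by
    have := Real.rpow_le_rpow (hp0 _) hP2 hq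
    rwa [Real.mul_rpow (Real.exp_pos _).le hprod0, ← Real.exp_mul, mul_comm _ q] at this
  have hPq' : Real.exp (-(q * U)) * (L.map p).prod ^ q ≤ p L.flatten ^ q := by
    have := Real.rpow_le_rpow (mul_nonneg (Real.exp_pos _).le hprod0) hP1 hq
    rwa [Real.mul_rpow (Real.exp_pos _).le hprod0, ← Real.exp_mul, neg_mul, mul_comm _ q] at this
  have hup : s ≤ tf q + tg q → svf P S tf tg a1 a2 s q L.flatten
      ≤ (L.map fun w => Real.exp (q * u w.length + e w.length)).prod
        * (L.map (svf P S tf tg a1 a2 s q)).prod := fun hs => by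
    rw [hC, hR, hsvf]
    refine (mul_le_mul hPq (Real.exp_le_exp.2 ((heL L).1 hs)) (Real.exp_pos _).le
      (by positivity)).trans_eq ?_
    rw [Real.exp_add, Real.exp_add]
    ring
  have hlow : tf q + tg q ≤ s →
      ((L.map fun w => Real.exp (q * u w.length + e w.length)).prod)⁻¹
        * (L.map (svf P S tf tg a1 a2 s q)).prod
      ≤ svf P S tf tg a1 a2 s q L.flatten := fun hs => by
    rw [hC, hR, hsvf]
    refine le_trans (le_of_eq ?_) (mul_le_mul hPq' (Real.exp_le_exp.2 ((heL L).2 hs))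
      (Real.exp_pos _).le (Real.rpow_nonneg (hp0 _) q))
    rw [← Real.exp_neg, neg_add, Real.exp_add, Real.exp_add]
    ring
  exact ⟨fun hs => hup hs.le, fun hs => ⟨hlow hs.ge, hup hs.le⟩, fun hs => hlow hs.le⟩
end

section
/- Let μ = ℙ∘Π^{-1} be an almost quasi-Bernoulli measure on a parabolic carpet satisfying ∑_{i∈I_∞} |f_i([0,1])|^{α_f} < ∞ and ∑_{i∈I_∞} |g_i([0,1])|^{α_g} < ∞. Then for every s ∈ ℝ and q ≥ 0 the pressure P(s,q) := lim_{n→∞} (∑_{i∈I^n} ℙ([i])^q ᾱ₁(i)^{t(i,q)} ᾱ₂(i)^{s−t(i,q)})^{1/n} exists. -/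
open Set Filter MeasureTheory Metric Topology
open scoped ENNReal NNReal

variable {I : Type} [Fintype I]

/-! ### Weakly contracting systems of interval maps -/

/-- A family of differentiable self-maps of `[0,1]` which strictly decrease distances and have
continuous nowhere vanishing derivatives. -/
structure WeaklyContracting {ι : Type} (h h' : ι → ℝ → ℝ) : Prop where
  maps : ∀ i, MapsTo (h i) (Icc (0:ℝ) 1) (Icc (0:ℝ) 1)
  contract : ∀ i, ∀ x ∈ Icc (0:ℝ) 1, ∀ y ∈ Icc (0:ℝ) 1, x ≠ y → |h i x - h i y| < |x - y|
  hasDeriv : ∀ i, ∀ x ∈ Icc (0:ℝ) 1, HasDerivWithinAt (h i) (h' i x) (Icc (0:ℝ) 1) x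
  cont : ∀ i, ContinuousOn (h' i) (Icc (0:ℝ) 1)
  nonzero : ∀ i, ∀ x ∈ Icc (0:ℝ) 1, h' i x ≠ 0

theorem continuousOn_of_holder {φ : ℝ → ℝ} {s : Set ℝ} {C α : ℝ} (hα : 0 < α)
    (hφ : ∀ x ∈ s, ∀ y ∈ s, |φ x - φ y| ≤ C * |x - y| ^ α) : ContinuousOn φ s := by
  intro x hx
  rw [ContinuousWithinAt, tendsto_iff_dist_tendsto_zero]
  have hlim : Tendsto (fun y => C * |y - x| ^ α) (𝓝[s] x) (𝓝 0) := by
    have hc : Continuous fun y => C * |y - x| ^ α :=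
      continuous_const.mul
        ((continuous_id.sub continuous_const).abs.rpow_const fun _ => Or.inr hα.le)
    have := hc.continuousWithinAt (s := s) (x := x)
    simpa [ContinuousWithinAt, Real.zero_rpow hα.ne'] using this
  refine squeeze_zero' (Eventually.of_forall fun _ => dist_nonneg) ?_ hlim
  filter_upwards [self_mem_nhdsWithin] with y hy
  exact hφ y hy x hx

namespace WeaklyContracting

variable {ι : Type} {h h' : ι → ℝ → ℝ}

theorem mapsTo_wMap (H : WeaklyContracting h h') (w : List ι) :
    MapsTo (wMap h w) (Icc (0:ℝ) 1) (Icc (0:ℝ) 1) := by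
  induction w with
  | nil => exact fun x hx => hx
  | cons a t ih => exact (H.maps a).comp ih

theorem wDeriv_ne_zero (H : WeaklyContracting h h') (w : List ι) {x : ℝ}
    (hx : x ∈ Icc (0:ℝ) 1) : wDeriv h h' w x ≠ 0 := by
  induction w with
  | nil => exact one_ne_zero
  | cons a t ih => exact mul_ne_zero (H.nonzero a _ (H.mapsTo_wMap t hx)) ih

theorem hasDerivWithinAt_wMap (H : WeaklyContracting h h') (w : List ι) {x : ℝ}
    (hx : x ∈ Icc (0:ℝ) 1) :
    HasDerivWithinAt (wMap h w) (wDeriv h h' w x) (Icc (0:ℝ) 1) x := by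
  induction w with
  | nil => exact hasDerivWithinAt_id x _
  | cons a t ih =>
    exact (H.hasDeriv a _ (H.mapsTo_wMap t hx)).comp x ih (H.mapsTo_wMap t)

theorem exists_wMap_sub_eq (H : WeaklyContracting h h') (w : List ι) {x y : ℝ}
    (hx : x ∈ Icc (0:ℝ) 1) (hy : y ∈ Icc (0:ℝ) 1) :
    ∃ z ∈ Icc (0:ℝ) 1, wMap h w y - wMap h w x = wDeriv h h' w z * (y - x) := by
  wlog hxy : x ≤ y generalizing x y
  · obtain ⟨z, hz, e⟩ := this hy hx (le_of_not_ge hxy)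
    exact ⟨z, hz, by linear_combination -e⟩
  rcases hxy.eq_or_lt with rfl | hlt
  · exact ⟨x, hx, by ring⟩
  have hsub : Icc x y ⊆ Icc (0:ℝ) 1 := Icc_subset_Icc hx.1 hy.2
  obtain ⟨z, hz, e⟩ := exists_hasDerivAt_eq_slope (wMap h w) (wDeriv h h' w) hlt
    (fun z hz => ((H.hasDerivWithinAt_wMap w (hsub hz)).mono hsub).continuousWithinAt)
    (fun z hz => (H.hasDerivWithinAt_wMap w (hsub (Ioo_subset_Icc_self hz))).hasDerivAt
      (Icc_mem_nhds (hx.1.trans_lt hz.1) (hz.2.trans_le hy.2)))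
  refine ⟨z, hsub (Ioo_subset_Icc_self hz), ?_⟩
  rw [e, div_mul_cancel₀ _ (sub_pos.2 hlt).ne']

theorem continuousOn (H : WeaklyContracting h h') (i : ι) :
    ContinuousOn (h i) (Icc (0:ℝ) 1) :=
  fun x hx => (H.hasDeriv i x hx).continuousWithinAt

theorem abs_sub_le (H : WeaklyContracting h h') (i : ι) {x y : ℝ}
    (hx : x ∈ Icc (0:ℝ) 1) (hy : y ∈ Icc (0:ℝ) 1) : |h i x - h i y| ≤ |x - y| := by
  rcases eq_or_ne x y with rfl | hxy
  · simp
  · exact (H.contract i x hx y hy hxy).le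

theorem continuousOn_log (H : WeaklyContracting h h') (i : ι) :
    ContinuousOn (fun x => Real.log (h' i x)) (Icc (0:ℝ) 1) :=
  (H.cont i).log (H.nonzero i)

theorem log_wDeriv_cons (H : WeaklyContracting h h') (a : ι) (t : List ι) {x : ℝ}
    (hx : x ∈ Icc (0:ℝ) 1) :
    Real.log (wDeriv h h' (a :: t) x)
      = Real.log (h' a (wMap h t x)) + Real.log (wDeriv h h' t x) :=
  Real.log_mul (H.nonzero a _ (H.mapsTo_wMap t hx)) (H.wDeriv_ne_zero t hx)

theorem log_wDeriv_append (H : WeaklyContracting h h') (u v : List ι) {x : ℝ}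
    (hx : x ∈ Icc (0:ℝ) 1) :
    Real.log (wDeriv h h' (u ++ v) x)
      = Real.log (wDeriv h h' u (wMap h v x)) + Real.log (wDeriv h h' v x) := by
  have hmap : ∀ u : List ι, wMap h (u ++ v) x = wMap h u (wMap h v x) := by
    intro u
    induction u with
    | nil => rfl
    | cons a t ih => exact congrArg (h a) ih
  induction u with
  | nil => simp [wDeriv]
  | cons a t ih =>
    rw [List.cons_append, H.log_wDeriv_cons a _ hx,
      H.log_wDeriv_cons a _ (H.mapsTo_wMap v hx), ih, hmap, add_assoc]

theorem abs_wDeriv_eq_exp (H : WeaklyContracting h h') (w : List ι) {x : ℝ}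
    (hx : x ∈ Icc (0:ℝ) 1) : |wDeriv h h' w x| = Real.exp (Real.log (wDeriv h h' w x)) :=
  (Real.exp_log_eq_abs (H.wDeriv_ne_zero w hx)).symm

/-- The images of `[0,1]` under long words are uniformly small. -/
theorem exists_length_forall_abs_sub_lt [Finite ι] (H : WeaklyContracting h h') {η : ℝ}
    (hη : 0 < η) : ∃ N : ℕ, ∀ w : List ι, N ≤ w.length → ∀ x ∈ Icc (0:ℝ) 1,
      ∀ y ∈ Icc (0:ℝ) 1, |wMap h w x - wMap h w y| < η := by
  have hgap : ∀ i, ∀ᶠ θ in 𝓝[>] (0:ℝ), ∀ x ∈ Icc (0:ℝ) 1, ∀ y ∈ Icc (0:ℝ) 1,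
      η ≤ |x - y| → |h i x - h i y| ≤ |x - y| - θ := by
    intro i
    have hK : IsCompact ((Icc (0:ℝ) 1 ×ˢ Icc (0:ℝ) 1) ∩ {p : ℝ × ℝ | η ≤ |p.1 - p.2|}) :=
      (isCompact_Icc.prod isCompact_Icc).inter_right
        (isClosed_le continuous_const (by fun_prop))
    have hcont : ContinuousOn (fun p : ℝ × ℝ => |p.1 - p.2| - |h i p.1 - h i p.2|)
        ((Icc (0:ℝ) 1 ×ˢ Icc (0:ℝ) 1) ∩ {p : ℝ × ℝ | η ≤ |p.1 - p.2|}) := by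
      refine ContinuousOn.sub (by fun_prop) (ContinuousOn.abs (ContinuousOn.sub ?_ ?_))
      · exact (H.continuousOn i).comp continuousOn_fst fun p hp => hp.1.1
      · exact (H.continuousOn i).comp continuousOn_snd fun p hp => hp.1.2
    obtain ⟨a, ha, hmin⟩ := hK.exists_forall_le' hcont (a := 0) (by
      rintro ⟨x, y⟩ ⟨⟨hx, hy⟩, hxy⟩
      refine sub_pos.2 (H.contract i x hx y hy ?_)
      rintro rfl
      simp only [mem_ofPred_eq, sub_self, abs_zero] at hxy
      exact absurd hη (not_lt.2 hxy))
    filter_upwards [Ioo_mem_nhdsGT ha] with θ hθ x hx y hy hxy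
    have := hmin (x, y) ⟨⟨hx, hy⟩, hxy⟩
    simp only at this
    linarith [hθ.2]
  obtain ⟨θ, hgap, hθ⟩ := ((eventually_all.2 hgap).and self_mem_nhdsWithin).exists
  have hdecr : ∀ w : List ι, ∀ x ∈ Icc (0:ℝ) 1, ∀ y ∈ Icc (0:ℝ) 1,
      η ≤ |wMap h w x - wMap h w y| → |wMap h w x - wMap h w y| ≤ 1 - θ * w.length := by
    intro w x hx y hy
    induction w with
    | nil =>
      intro _
      simp only [wMap, id, List.length_nil, Nat.cast_zero, mul_zero, sub_zero]
      rw [abs_le]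
      constructor <;> linarith [hx.1, hx.2, hy.1, hy.2]
    | cons a t ih =>
      intro hle
      have hx' := H.mapsTo_wMap t hx
      have hy' := H.mapsTo_wMap t hy
      have hle' : η ≤ |wMap h t x - wMap h t y| := hle.trans (H.abs_sub_le a hx' hy')
      have := hgap a _ hx' _ hy' hle'
      have := ih hle'
      simp only [wMap, Function.comp, List.length_cons, Nat.cast_add, Nat.cast_one]
      linarith
  obtain ⟨N, hN⟩ := exists_nat_gt (1 / θ)
  refine ⟨N, fun w hw x hx y hy => ?_⟩
  by_contra! hcon
  have h1 := hdecr w x hx y hy hcon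
  have h2 : (N : ℝ) ≤ w.length := by exact_mod_cast hw
  rw [div_lt_iff₀ hθ] at hN
  nlinarith

theorem exists_abs_log_le [Finite ι] (H : WeaklyContracting h h') :
    ∃ B : ℝ, 0 ≤ B ∧ ∀ i, ∀ x ∈ Icc (0:ℝ) 1, |Real.log (h' i x)| ≤ B := by
  have hB : ∀ i, ∀ᶠ B in atTop, ∀ x ∈ Icc (0:ℝ) 1, |Real.log (h' i x)| ≤ B := by
    intro i
    obtain ⟨B, hB⟩ := isCompact_Icc.exists_bound_of_continuousOn (H.continuousOn_log i)
    filter_upwards [eventually_ge_atTop B] with b hb x hx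
    exact (hB x hx).trans hb
  obtain ⟨B, hB, h0⟩ := ((eventually_all.2 hB).and (eventually_ge_atTop (0:ℝ))).exists
  exact ⟨B, h0, hB⟩

theorem exists_abs_log_wDeriv_le [Finite ι] (H : WeaklyContracting h h') :
    ∃ B : ℝ, 0 ≤ B ∧ ∀ w : List ι, ∀ x ∈ Icc (0:ℝ) 1,
      |Real.log (wDeriv h h' w x)| ≤ B * w.length := by
  obtain ⟨B, h0, hB⟩ := H.exists_abs_log_le
  refine ⟨B, h0, fun w x hx => ?_⟩
  induction w with
  | nil => simp [wDeriv]
  | cons a t ih =>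
    rw [H.log_wDeriv_cons a t hx, List.length_cons, Nat.cast_add, Nat.cast_one]
    have := hB a _ (H.mapsTo_wMap t hx)
    linarith [abs_add_le (Real.log (h' a (wMap h t x))) (Real.log (wDeriv h h' t x))]

/-- The logarithmic distortion of long words grows sublinearly. -/
theorem exists_distortion_le_add [Finite ι] (H : WeaklyContracting h h') {ε : ℝ}
    (hε : 0 < ε) : ∃ C : ℝ, ∀ w : List ι, ∀ x ∈ Icc (0:ℝ) 1, ∀ y ∈ Icc (0:ℝ) 1,
      |Real.log (wDeriv h h' w x) - Real.log (wDeriv h h' w y)| ≤ C + ε * w.length := by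
  have huc : ∀ i, ∀ᶠ η in 𝓝[>] (0:ℝ), ∀ x ∈ Icc (0:ℝ) 1, ∀ y ∈ Icc (0:ℝ) 1,
      |x - y| < η → |Real.log (h' i x) - Real.log (h' i y)| ≤ ε := by
    intro i
    obtain ⟨a, ha, hu⟩ := Metric.uniformContinuousOn_iff.1
      (isCompact_Icc.uniformContinuousOn_of_continuous (H.continuousOn_log i)) ε hε
    filter_upwards [Ioo_mem_nhdsGT ha] with η hη x hx y hy hxy
    exact (hu x hx y hy (hxy.trans hη.2)).le
  obtain ⟨η, huc, hη⟩ := ((eventually_all.2 huc).and self_mem_nhdsWithin).exists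
  obtain ⟨N, hN⟩ := H.exists_length_forall_abs_sub_lt hη
  obtain ⟨B, hB0, hB⟩ := H.exists_abs_log_le
  have key : ∀ w : List ι, ∀ x ∈ Icc (0:ℝ) 1, ∀ y ∈ Icc (0:ℝ) 1,
      |Real.log (wDeriv h h' w x) - Real.log (wDeriv h h' w y)|
        ≤ 2 * B * (min w.length N : ℕ) + ε * w.length := by
    intro w x hx y hy
    induction w with
    | nil => simp [wDeriv]
    | cons a t ih =>
      have hx' := H.mapsTo_wMap t hx
      have hy' := H.mapsTo_wMap t hy
      rw [H.log_wDeriv_cons a t hx, H.log_wDeriv_cons a t hy, List.length_cons]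
      have htri := abs_add_le (Real.log (h' a (wMap h t x)) - Real.log (h' a (wMap h t y)))
        (Real.log (wDeriv h h' t x) - Real.log (wDeriv h h' t y))
      rw [show ∀ p q r s : ℝ, p + q - (r + s) = p - r + (q - s) from fun _ _ _ _ => by ring]
      rcases le_or_gt N t.length with hlen | hlen
      · have h1 := huc a _ hx' _ hy' (hN t hlen x hx y hy)
        rw [min_eq_right hlen] at ih
        rw [min_eq_right (by omega)]
        push_cast
        linarith
      · have h1 := abs_sub (Real.log (h' a (wMap h t x))) (Real.log (h' a (wMap h t y)))
        have h2 := hB a _ hx'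
        have h3 := hB a _ hy'
        rw [min_eq_left hlen.le] at ih
        rw [min_eq_left (by omega)]
        push_cast
        linarith
  refine ⟨2 * B * N, fun w x hx y hy => (key w x hx y hy).trans ?_⟩
  gcongr
  exact min_le_right _ _

/-- Tempered distortion. -/
theorem exists_tempered_distortion [Finite ι] (H : WeaklyContracting h h') :
    ∃ d : ℕ → ℝ, Tendsto (fun n : ℕ => d n / n) atTop (𝓝 0) ∧
      ∀ w : List ι, ∀ x ∈ Icc (0:ℝ) 1, ∀ y ∈ Icc (0:ℝ) 1,
        |Real.log (wDeriv h h' w x) - Real.log (wDeriv h h' w y)| ≤ d w.length := by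
  set F : List ι × Icc (0:ℝ) 1 × Icc (0:ℝ) 1 → ℝ := fun p =>
    |Real.log (wDeriv h h' p.1 p.2.1) - Real.log (wDeriv h h' p.1 p.2.2)| with hF
  set d : ℕ → ℝ := fun n => sSup (F '' {p | p.1.length = n}) with hd
  have hd0 : ∀ n, 0 ≤ d n := fun n => Real.sSup_nonneg (by rintro _ ⟨p, -, rfl⟩; positivity)
  refine ⟨d, ?_, fun w x hx y hy => ?_⟩
  · rw [Metric.tendsto_atTop]
    intro ε hε
    obtain ⟨C, hC⟩ := H.exists_distortion_le_add (half_pos hε)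
    have hle : ∀ n : ℕ, d n ≤ |C| + ε / 2 * n := fun n =>
      Real.sSup_le (by
        rintro _ ⟨⟨w, x, y⟩, rfl, rfl⟩
        exact (hC w x x.2 y y.2).trans (by gcongr; exact le_abs_self C)) (by positivity)
    obtain ⟨N, hN⟩ := exists_nat_gt (2 * |C| / ε)
    refine ⟨N + 1, fun n hn => ?_⟩
    have hn' : (N : ℝ) + 1 ≤ n := by exact_mod_cast hn
    have hn0 : (0 : ℝ) < n := by linarith [Nat.cast_nonneg (α := ℝ) N]
    rw [Real.dist_0_eq_abs, abs_of_nonneg (div_nonneg (hd0 n) hn0.le), div_lt_iff₀ hn0]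
    rw [div_lt_iff₀ hε] at hN
    nlinarith [hle n]
  · obtain ⟨C, hC⟩ := H.exists_distortion_le_add one_pos
    refine le_csSup ⟨C + 1 * w.length, ?_⟩ ⟨(w, ⟨x, hx⟩, ⟨y, hy⟩), rfl, rfl⟩
    rintro _ ⟨⟨v, x, y⟩, hv, rfl⟩
    simp only [mem_ofPred_eq] at hv
    rw [← hv]
    exact hC v x x.2 y y.2

theorem abs_log_diam_sub_le (H : WeaklyContracting h h') (w : List ι) {d : ℝ}
    (hd : ∀ x ∈ Icc (0:ℝ) 1, ∀ y ∈ Icc (0:ℝ) 1,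
      |Real.log (wDeriv h h' w x) - Real.log (wDeriv h h' w y)| ≤ d) :
    Real.exp (Real.log (wDeriv h h' w 0) - d) ≤ diam (wMap h w '' Icc (0:ℝ) 1) ∧
      diam (wMap h w '' Icc (0:ℝ) 1) ≤ Real.exp (Real.log (wDeriv h h' w 0) + d) := by
  have m0 : (0:ℝ) ∈ Icc (0:ℝ) 1 := by simp
  have m1 : (1:ℝ) ∈ Icc (0:ℝ) 1 := by simp
  constructor
  · obtain ⟨z, hz, e⟩ := H.exists_wMap_sub_eq w m0 m1
    have hb : Bornology.IsBounded (wMap h w '' Icc (0:ℝ) 1) :=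
      (Metric.isBounded_Icc 0 1).subset (H.mapsTo_wMap w).image_subset
    refine le_trans ?_ (dist_le_diam_of_mem hb (mem_image_of_mem _ m1) (mem_image_of_mem _ m0))
    rw [Real.dist_eq, e, sub_zero, mul_one, H.abs_wDeriv_eq_exp w hz]
    exact Real.exp_le_exp.2 (by linarith [(abs_le.1 (hd z hz 0 m0)).1])
  · refine diam_le_of_forall_dist_le (Real.exp_nonneg _) ?_
    rintro _ ⟨x, hx, rfl⟩ _ ⟨y, hy, rfl⟩
    obtain ⟨z, hz, e⟩ := H.exists_wMap_sub_eq w hy hx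
    rw [Real.dist_eq, e, abs_mul, H.abs_wDeriv_eq_exp w hz]
    have h1 : |x - y| ≤ 1 := by
      rw [abs_le]
      constructor <;> linarith [hx.1, hx.2, hy.1, hy.2]
    calc _ ≤ Real.exp (Real.log (wDeriv h h' w z)) * 1 := by gcongr
      _ ≤ _ := by
        rw [mul_one]
        exact Real.exp_le_exp.2 (by linarith [(abs_le.1 (hd z hz 0 m0)).2])

end WeaklyContracting

/-! ### Nearly multiplicative weights on words -/

/-- Submultiplicativity under concatenation, up to subexponential factors. -/
def NearlySubmul {ι : Type} (W : List ι → ℝ) : Prop :=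
  ∃ ε : ℕ → ℝ, Tendsto (fun n : ℕ => ε n / n) atTop (𝓝 0) ∧
    ∀ L : List (List ι), (∀ w ∈ L, w ≠ []) →
      W L.flatten ≤ (L.map fun w => Real.exp (ε w.length) * W w).prod

/-- Supermultiplicativity under concatenation, up to subexponential factors. -/
def NearlySupermul {ι : Type} (W : List ι → ℝ) : Prop :=
  ∃ ε : ℕ → ℝ, Tendsto (fun n : ℕ => ε n / n) atTop (𝓝 0) ∧
    ∀ L : List (List ι), (∀ w ∈ L, w ≠ []) →
      (L.map fun w => Real.exp (-ε w.length) * W w).prod ≤ W L.flatten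

theorem exists_tendsto_div_of_subadditive_of_abs_sub_le {a b ε : ℕ → ℝ} {C : ℝ}
    (ha : Subadditive a) (hε : Tendsto (fun n : ℕ => ε n / n) atTop (𝓝 0))
    (hab : ∀ n, n ≠ 0 → |a n - b n| ≤ ε n) (hb : ∀ n : ℕ, -(C * n) ≤ b n) :
    ∃ L, Tendsto (fun n : ℕ => b n / n) atTop (𝓝 L) := by
  have hdist : ∀ n : ℕ, |a n / n - b n / n| ≤ ε n / n := by
    intro n
    rcases eq_or_ne n 0 with rfl | hn
    · simp
    · rw [← sub_div, abs_div, Nat.abs_cast]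
      exact div_le_div_of_nonneg_right (hab n hn) n.cast_nonneg
  obtain ⟨M, hM⟩ := hε.bddAbove_range
  have hlim := ha.tendsto_lim ⟨-|C| - M, by
    rintro _ ⟨n, rfl⟩
    have h1 : -|C| ≤ b n / n := by
      rcases n.eq_zero_or_pos with rfl | hn
      · simp
      · rw [le_div_iff₀ (by exact_mod_cast hn)]
        nlinarith [hb n, mul_le_mul_of_nonneg_right (le_abs_self C) n.cast_nonneg]
    have h2 : ε n / n ≤ M := hM ⟨n, rfl⟩
    linarith [(abs_le.1 (hdist n)).1]⟩
  have hsub := squeeze_zero_norm (f := fun n : ℕ => a n / n - b n / n) hdist hε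
  exact ⟨ha.lim, by simpa using hlim.sub hsub⟩

theorem sum_ofFn_add {ι : Type} [Fintype ι] (W : List ι → ℝ) (m n : ℕ) :
    ∑ w : Fin (m + n) → ι, W (List.ofFn w)
      = ∑ u : Fin m → ι, ∑ v : Fin n → ι, W (List.ofFn u ++ List.ofFn v) := by
  rw [← (Fin.appendEquiv m n).sum_comp, Fintype.sum_prod_type]
  simp [Fin.appendEquiv, List.ofFn_fin_append]

theorem abs_log_sub_log_le {x y e : ℝ} (hy : 0 < y) (h1 : y ≤ x) (h2 : x ≤ Real.exp e * y) :
    |Real.log x - Real.log y| ≤ e := by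
  have hx := hy.trans_le h1
  have h3 := Real.log_le_log hy h1
  have h4 := Real.log_le_log hx h2
  rw [Real.log_mul (Real.exp_ne_zero _) hy.ne', Real.log_exp] at h4
  rw [abs_le]
  constructor <;> linarith

theorem exists_flatten_eq {ι : Type} (w : List ι) :
    ∃ L : List (List ι), (∀ u ∈ L, u ≠ []) ∧ L.flatten = w := by
  rcases eq_or_ne w [] with rfl | hw
  · exact ⟨[], by simp, rfl⟩
  · exact ⟨[w], by simpa using hw, by simp⟩

theorem NearlySubmul.exists_tendsto {ι : Type} [Fintype ι] {W : List ι → ℝ}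
    (hW : NearlySubmul W) (hW0 : ∀ w, 0 ≤ W w) {C : ℝ}
    (hlow : ∀ n : ℕ, Real.exp (-(C * n)) ≤ ∑ w : Fin n → ι, W (List.ofFn w)) :
    ∃ L, Tendsto (fun n : ℕ => Real.log (∑ w : Fin n → ι, W (List.ofFn w)) / n)
      atTop (𝓝 L) := by
  obtain ⟨ε, hε, hsub⟩ := hW
  set X : List ι → Type := fun w => {L : List (List ι) // (∀ u ∈ L, u ≠ []) ∧ L.flatten = w}
  have hne : ∀ w, Nonempty (X w) := fun w => nonempty_subtype.2 (exists_flatten_eq w)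
  set p : List (List ι) → ℝ := fun L => (L.map fun w => Real.exp (ε w.length) * W w).prod
  have hpapp : ∀ L M, p (L ++ M) = p L * p M := fun L M => by
    simp only [p, List.map_append, List.prod_append]
  have hpsing : ∀ w, p [w] = Real.exp (ε w.length) * W w := fun w => List.prod_singleton
  have hp0 : ∀ L, 0 ≤ p L := fun L => List.prod_nonneg (by
    simp only [List.mem_map]
    rintro _ ⟨w, -, rfl⟩
    exact mul_nonneg (Real.exp_nonneg _) (hW0 w))
  set U : List ι → ℝ := fun w => ⨅ L : X w, p L.1 with hU
  have hbdd : ∀ w, BddBelow (range fun L : X w => p L.1) := fun w =>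
    ⟨0, by rintro _ ⟨L, rfl⟩; exact hp0 _⟩
  have hU0 : ∀ w, 0 ≤ U w := fun w => Real.iInf_nonneg fun L => hp0 _
  have hWU : ∀ w, W w ≤ U w := fun w =>
    le_ciInf fun ⟨L, hL, e⟩ => by subst e; exact hsub L hL
  have hUW : ∀ w, w ≠ [] → U w ≤ Real.exp (ε w.length) * W w := by
    intro w hw
    exact (ciInf_le (hbdd w) ⟨[w], by simpa using hw, by simp⟩).trans_eq (hpsing w)
  have hUmul : ∀ u v, U (u ++ v) ≤ U u * U v := by
    intro u v
    rw [hU, Real.iInf_mul_of_nonneg (hU0 v)]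
    refine le_ciInf fun ⟨L, hL, eL⟩ => ?_
    rw [Real.mul_iInf_of_nonneg (hp0 _)]
    refine le_ciInf fun ⟨M, hM, eM⟩ => ?_
    refine (ciInf_le (hbdd _) ⟨L ++ M, ?_, by simp [eL, eM]⟩).trans_eq (hpapp L M)
    simp only [List.mem_append]
    rintro w (hw | hw)
    exacts [hL w hw, hM w hw]
  set Z : ℕ → ℝ := fun n => ∑ w : Fin n → ι, W (List.ofFn w)
  have hZpos : ∀ n, 0 < Z n := fun n => (Real.exp_pos _).trans_le (hlow n)
  have hZle : ∀ n, Z n ≤ ∑ w : Fin n → ι, U (List.ofFn w) :=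
    fun n => Finset.sum_le_sum fun w _ => hWU _
  have hpos : ∀ n, 0 < ∑ w : Fin n → ι, U (List.ofFn w) :=
    fun n => (hZpos n).trans_le (hZle n)
  refine exists_tendsto_div_of_subadditive_of_abs_sub_le
    (a := fun n => Real.log (∑ w : Fin n → ι, U (List.ofFn w)))
    (b := fun n => Real.log (Z n)) (C := C) ?_ hε ?_ ?_
  · intro m n
    rw [← Real.log_mul (hpos m).ne' (hpos n).ne']
    refine Real.log_le_log (hpos _) ?_
    rw [sum_ofFn_add, Finset.sum_mul_sum]
    exact Finset.sum_le_sum fun u _ => Finset.sum_le_sum fun v _ => hUmul _ _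
  · intro n hn
    refine abs_log_sub_log_le (hZpos n) (hZle n) ?_
    simp only [Z, Finset.mul_sum]
    refine Finset.sum_le_sum fun w _ => ?_
    simpa using hUW (List.ofFn w) (by simpa [List.ofFn_eq_nil_iff] using hn)
  · intro n
    rw [Real.le_log_iff_exp_le (hZpos n)]
    exact hlow n

theorem NearlySupermul.exists_tendsto {ι : Type} [Fintype ι] {W : List ι → ℝ}
    (hW : NearlySupermul W) (hW0 : ∀ w, 0 ≤ W w) {C : ℝ}
    (hpos : ∀ n : ℕ, 0 < ∑ w : Fin n → ι, W (List.ofFn w))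
    (hup : ∀ n : ℕ, ∑ w : Fin n → ι, W (List.ofFn w) ≤ Real.exp (C * n)) :
    ∃ L, Tendsto (fun n : ℕ => Real.log (∑ w : Fin n → ι, W (List.ofFn w)) / n)
      atTop (𝓝 L) := by
  obtain ⟨ε, hε, hsup⟩ := hW
  set X : List ι → Type := fun w => {L : List (List ι) // (∀ u ∈ L, u ≠ []) ∧ L.flatten = w}
  have hne : ∀ w, Nonempty (X w) := fun w => nonempty_subtype.2 (exists_flatten_eq w)
  set p : List (List ι) → ℝ := fun L => (L.map fun w => Real.exp (-ε w.length) * W w).prod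
  have hpapp : ∀ L M, p (L ++ M) = p L * p M := fun L M => by
    simp only [p, List.map_append, List.prod_append]
  have hpsing : ∀ w, p [w] = Real.exp (-ε w.length) * W w := fun w => List.prod_singleton
  have hp0 : ∀ L, 0 ≤ p L := fun L => List.prod_nonneg (by
    simp only [List.mem_map]
    rintro _ ⟨w, -, rfl⟩
    exact mul_nonneg (Real.exp_nonneg _) (hW0 w))
  set U : List ι → ℝ := fun w => ⨆ L : X w, p L.1 with hU
  have hpW : ∀ w, ∀ L : X w, p L.1 ≤ W w := fun w ⟨L, hL, e⟩ => by subst e; exact hsup L hL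
  have hbdd : ∀ w, BddAbove (range fun L : X w => p L.1) := fun w =>
    ⟨W w, by rintro _ ⟨L, rfl⟩; exact hpW w L⟩
  have hU0 : ∀ w, 0 ≤ U w := fun w => Real.iSup_nonneg fun L => hp0 _
  have hUW : ∀ w, U w ≤ W w := fun w => ciSup_le (hpW w)
  have hWU : ∀ w, w ≠ [] → W w ≤ Real.exp (ε w.length) * U w := by
    intro w hw
    have hle : p [w] ≤ U w := le_ciSup (hbdd w) ⟨[w], by simpa using hw, by simp⟩
    rwa [hpsing, Real.exp_neg, inv_mul_le_iff₀ (Real.exp_pos _)] at hle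
  have hUmul : ∀ u v, U u * U v ≤ U (u ++ v) := by
    intro u v
    rw [hU, Real.iSup_mul_of_nonneg (hU0 v)]
    refine ciSup_le fun ⟨L, hL, eL⟩ => ?_
    rw [Real.mul_iSup_of_nonneg (hp0 _)]
    refine ciSup_le fun ⟨M, hM, eM⟩ => ?_
    refine (hpapp L M).symm.trans_le (le_ciSup (hbdd _) ⟨L ++ M, ?_, by simp [eL, eM]⟩)
    simp only [List.mem_append]
    rintro w (hw | hw)
    exacts [hL w hw, hM w hw]
  set Z : ℕ → ℝ := fun n => ∑ w : Fin n → ι, W (List.ofFn w)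
  have hleZ : ∀ n, ∑ w : Fin n → ι, U (List.ofFn w) ≤ Z n :=
    fun n => Finset.sum_le_sum fun w _ => hUW _
  have hZle : ∀ n, n ≠ 0 → Z n ≤ Real.exp (ε n) * ∑ w : Fin n → ι, U (List.ofFn w) := by
    intro n hn
    simp only [Z, Finset.mul_sum]
    refine Finset.sum_le_sum fun w _ => ?_
    simpa using hWU (List.ofFn w) (by simpa [List.ofFn_eq_nil_iff] using hn)
  have hUpos : ∀ n, 0 < ∑ w : Fin n → ι, U (List.ofFn w) := by
    intro n
    rcases eq_or_ne n 0 with rfl | hn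
    · have hle : p [] ≤ U [] := le_ciSup (hbdd []) ⟨[], by simp, rfl⟩
      have hnil : p [] = 1 := List.prod_nil
      simpa using (one_pos.trans_eq hnil.symm).trans_le hle
    · exact pos_of_mul_pos_right ((hpos n).trans_le (hZle n hn)) (Real.exp_nonneg _)
  have hadd : Subadditive fun n => -Real.log (∑ w : Fin n → ι, U (List.ofFn w)) := by
    intro m n
    rw [← neg_add, neg_le_neg_iff, ← Real.log_mul (hUpos m).ne' (hUpos n).ne']
    refine Real.log_le_log (mul_pos (hUpos m) (hUpos n)) ?_
    rw [sum_ofFn_add, Finset.sum_mul_sum]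
    exact Finset.sum_le_sum fun u _ => Finset.sum_le_sum fun v _ => hUmul _ _
  obtain ⟨L, hL⟩ := exists_tendsto_div_of_subadditive_of_abs_sub_le
    (b := fun n => -Real.log (Z n)) (C := C) hadd hε
    (fun n hn => by
      rw [neg_sub_neg]
      exact abs_log_sub_log_le (hUpos n) (hleZ n) (hZle n hn))
    (fun n => by
      rw [neg_le_neg_iff, Real.log_le_iff_le_exp (hpos n)]
      exact hup n)
  exact ⟨-L, by simpa [neg_div] using hL.neg⟩

theorem NearlySubmul.mul {ι : Type} {V W : List ι → ℝ} (hV : NearlySubmul V)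
    (hW : NearlySubmul W) (hV0 : ∀ w, 0 ≤ V w) (hW0 : ∀ w, 0 ≤ W w) :
    NearlySubmul fun w => V w * W w := by
  obtain ⟨ε, hε, hsub⟩ := hV
  obtain ⟨δ, hδ, hsub'⟩ := hW
  refine ⟨fun n => ε n + δ n, by simpa [add_div] using hε.add hδ, fun L hL => ?_⟩
  refine (mul_le_mul (hsub L hL) (hsub' L hL) (hW0 _) ((hV0 _).trans (hsub L hL))).trans_eq ?_
  rw [← List.prod_map_mul]
  simp only [Real.exp_add, mul_mul_mul_comm]

theorem NearlySupermul.mul {ι : Type} {V W : List ι → ℝ} (hV : NearlySupermul V)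
    (hW : NearlySupermul W) (hV0 : ∀ w, 0 ≤ V w) (hW0 : ∀ w, 0 ≤ W w) :
    NearlySupermul fun w => V w * W w := by
  obtain ⟨ε, hε, hsup⟩ := hV
  obtain ⟨δ, hδ, hsup'⟩ := hW
  refine ⟨fun n => ε n + δ n, by simpa [add_div] using hε.add hδ, fun L hL => ?_⟩
  refine Eq.trans_le ?_ (mul_le_mul (hsup L hL) (hsup' L hL) (List.prod_nonneg ?_) (hV0 _))
  · rw [← List.prod_map_mul]
    simp only [neg_add, Real.exp_add, mul_mul_mul_comm]
  · simp only [List.mem_map]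
    rintro _ ⟨w, -, rfl⟩
    exact mul_nonneg (Real.exp_nonneg _) (hW0 w)

theorem NearlySubmul.rpow {ι : Type} {W : List ι → ℝ} (hW : NearlySubmul W)
    (hW0 : ∀ w, 0 ≤ W w) {q : ℝ} (hq : 0 ≤ q) : NearlySubmul fun w => W w ^ q := by
  obtain ⟨ε, hε, hsub⟩ := hW
  refine ⟨fun n => ε n * q, ?_, fun L hL => ?_⟩
  · simpa [mul_div_right_comm] using hε.mul_const q
  · refine (Real.rpow_le_rpow (hW0 _) (hsub L hL) hq).trans_eq ?_
    rw [← Real.list_prod_map_rpow' _ _ fun w _ => mul_nonneg (Real.exp_nonneg _) (hW0 w)]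
    simp only [Real.mul_rpow (Real.exp_nonneg _) (hW0 _), ← Real.exp_mul]

theorem NearlySupermul.rpow {ι : Type} {W : List ι → ℝ} (hW : NearlySupermul W)
    (hW0 : ∀ w, 0 ≤ W w) {q : ℝ} (hq : 0 ≤ q) : NearlySupermul fun w => W w ^ q := by
  obtain ⟨ε, hε, hsup⟩ := hW
  refine ⟨fun n => ε n * q, ?_, fun L hL => ?_⟩
  · simpa [mul_div_right_comm] using hε.mul_const q
  · refine Eq.trans_le ?_ (Real.rpow_le_rpow (List.prod_nonneg ?_) (hsup L hL) hq)
    · rw [← Real.list_prod_map_rpow' _ _ fun w _ => mul_nonneg (Real.exp_nonneg _) (hW0 w)]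
      simp only [Real.mul_rpow (Real.exp_nonneg _) (hW0 _), ← Real.exp_mul, neg_mul]
    · simp only [List.mem_map]
      rintro _ ⟨w, -, rfl⟩
      exact mul_nonneg (Real.exp_nonneg _) (hW0 w)

theorem nearlySubmul_exp {ι : Type} {ψ : List ι → ℝ} {ε : ℕ → ℝ}
    (hε : Tendsto (fun n : ℕ => ε n / n) atTop (𝓝 0)) (h0 : ψ [] = 0)
    (h : ∀ u v, ψ (u ++ v) ≤ ψ u + ψ v + ε u.length) :
    NearlySubmul fun w => Real.exp (ψ w) := by
  refine ⟨ε, hε, fun L _ => ?_⟩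
  induction L with
  | nil => simp [h0]
  | cons u L ih =>
    rw [List.flatten_cons, List.map_cons, List.prod_cons]
    have ih := ih fun w hw => ‹∀ w ∈ u :: L, w ≠ []› w (List.mem_cons_of_mem u hw)
    calc Real.exp (ψ (u ++ L.flatten))
        ≤ Real.exp (ε u.length) * Real.exp (ψ u) * Real.exp (ψ L.flatten) := by
          rw [← Real.exp_add, ← Real.exp_add]
          exact Real.exp_le_exp.2 (by linarith [h u L.flatten])
      _ ≤ _ := by gcongr

theorem nearlySupermul_exp {ι : Type} {ψ : List ι → ℝ} {ε : ℕ → ℝ}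
    (hε : Tendsto (fun n : ℕ => ε n / n) atTop (𝓝 0)) (h0 : ψ [] = 0)
    (h : ∀ u v, ψ u + ψ v - ε u.length ≤ ψ (u ++ v)) :
    NearlySupermul fun w => Real.exp (ψ w) := by
  refine ⟨ε, hε, fun L _ => ?_⟩
  induction L with
  | nil => simp [h0]
  | cons u L ih =>
    rw [List.flatten_cons, List.map_cons, List.prod_cons]
    have ih := ih fun w hw => ‹∀ w ∈ u :: L, w ≠ []› w (List.mem_cons_of_mem u hw)
    calc _ ≤ Real.exp (-ε u.length) * Real.exp (ψ u) * Real.exp (ψ L.flatten) := by gcongr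
      _ ≤ _ := by
          rw [← Real.exp_add, ← Real.exp_add]
          exact Real.exp_le_exp.2 (by linarith [h u L.flatten])

theorem WeakQB.nearlySubmul_and_nearlySupermul {ι : Type} [MeasurableSpace ι]
    {P : Measure (ℕ → ι)} (hP : WeakQB P) :
    NearlySubmul (fun w => (P (cyl w)).toReal) ∧ NearlySupermul fun w => (P (cyl w)).toReal := by
  obtain ⟨c, hc, hlim, hqb⟩ := hP
  have hε : Tendsto (fun n : ℕ => Real.log (c n) / n) atTop (𝓝 0) := by
    have := (Real.continuousAt_log one_ne_zero).tendsto.comp hlim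
    rw [Real.log_one] at this
    refine this.congr fun n => ?_
    rw [Function.comp, Real.log_rpow (hc n), div_eq_inv_mul]
  refine ⟨⟨_, hε, fun L hL => ?_⟩, ⟨_, hε, fun L hL => ?_⟩⟩
  · simpa only [Real.exp_log (hc _), List.prod_map_mul] using (hqb L hL).2
  · have hinv : ∀ L : List (List ι), (L.map fun w => (c w.length)⁻¹).prod
        = ((L.map fun w => c w.length).prod)⁻¹ := by
      intro L
      induction L with
      | nil => simp
      | cons u L ih => simp [ih, mul_comm]
    simpa only [Real.exp_neg, Real.exp_log (hc _), List.prod_map_mul, hinv] using (hqb L hL).1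

/-! ### The singular value weights of a carpet -/

theorem PCarpetIFS.weaklyContracting_fst (S : PCarpetIFS I) : WeaklyContracting S.f S.f' where
  maps := S.mapsf
  contract := S.contractf
  hasDeriv := S.hasDerivf
  cont i := by
    obtain ⟨C, -, hC⟩ := S.holderf
    exact continuousOn_of_holder S.αf_pos (hC i)
  nonzero := S.nonzerof

theorem PCarpetIFS.weaklyContracting_snd (S : PCarpetIFS I) : WeaklyContracting S.g S.g' where
  maps := S.mapsg
  contract := S.contractg
  hasDeriv := S.hasDerivg
  cont i := by
    obtain ⟨C, -, hC⟩ := S.holderg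
    exact continuousOn_of_holder S.αg_pos (hC i)
  nonzero := S.nonzerog

theorem abs_log_iSup_exp_sub_le {X : Type} [Nonempty X] {φ : X → ℝ} {m d : ℝ}
    (hφ : ∀ x, |φ x - m| ≤ d) :
    0 < ⨆ x, Real.exp (φ x) ∧ |Real.log (⨆ x, Real.exp (φ x)) - m| ≤ d := by
  have hle : ∀ x, Real.exp (φ x) ≤ Real.exp (m + d) := fun x =>
    Real.exp_le_exp.2 (by linarith [(abs_le.1 (hφ x)).2])
  obtain ⟨x⟩ := ‹Nonempty X›
  have hlow : Real.exp (m - d) ≤ ⨆ x, Real.exp (φ x) :=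
    (Real.exp_le_exp.2 (by linarith [(abs_le.1 (hφ x)).1])).trans
      (le_ciSup (f := fun x => Real.exp (φ x)) ⟨_, by rintro _ ⟨y, rfl⟩; exact hle y⟩ x)
  have hpos := (Real.exp_pos _).trans_le hlow
  refine ⟨hpos, ?_⟩
  have hup : ⨆ x, Real.exp (φ x) ≤ Real.exp (m + d) := ciSup_le hle
  rw [← Real.le_log_iff_exp_le hpos] at hlow
  rw [← Real.log_le_iff_le_exp hpos] at hup
  rw [abs_le]
  constructor <;> linarith

theorem abs_log_a1U_sub_le (S : PCarpetIFS I) (w : List I) {x y d : ℝ}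
    (hx : ∀ z ∈ Icc (0:ℝ) 1, |Real.log (wDeriv S.f S.f' w z) - x| ≤ d)
    (hy : ∀ z ∈ Icc (0:ℝ) 1, |Real.log (wDeriv S.g S.g' w z) - y| ≤ d) :
    0 < a1U S w ∧ |Real.log (a1U S w) - max x y| ≤ d := by
  have heq : a1U S w = ⨆ z : Icc (0:ℝ) 1, Real.exp
      (max (Real.log (wDeriv S.f S.f' w z)) (Real.log (wDeriv S.g S.g' w z))) := by
    refine iSup_congr fun z => ?_
    rw [Real.exp_monotone.map_max, S.weaklyContracting_fst.abs_wDeriv_eq_exp w z.2,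
      S.weaklyContracting_snd.abs_wDeriv_eq_exp w z.2]
  rw [heq]
  exact abs_log_iSup_exp_sub_le fun z =>
    (abs_max_sub_max_le_max _ _ _ _).trans (max_le (hx z z.2) (hy z z.2))

theorem abs_log_a2U_sub_le (S : PCarpetIFS I) (w : List I) {x y d : ℝ}
    (hx : ∀ z ∈ Icc (0:ℝ) 1, |Real.log (wDeriv S.f S.f' w z) - x| ≤ d)
    (hy : ∀ z ∈ Icc (0:ℝ) 1, |Real.log (wDeriv S.g S.g' w z) - y| ≤ d) :
    0 < a2U S w ∧ |Real.log (a2U S w) - min x y| ≤ d := by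
  have heq : a2U S w = ⨆ z : Icc (0:ℝ) 1, Real.exp
      (min (Real.log (wDeriv S.f S.f' w z)) (Real.log (wDeriv S.g S.g' w z))) := by
    refine iSup_congr fun z => ?_
    rw [Real.exp_monotone.map_min, S.weaklyContracting_fst.abs_wDeriv_eq_exp w z.2,
      S.weaklyContracting_snd.abs_wDeriv_eq_exp w z.2]
  rw [heq]
  exact abs_log_iSup_exp_sub_le fun z =>
    (abs_min_sub_min_le_max _ _ _ _).trans (max_le (hx z z.2) (hy z z.2))

theorem abs_mul_add_mul_sub_le {t r a b x y e : ℝ} (ha : |a - x| ≤ e) (hb : |b - y| ≤ e) :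
    |t * a + r * b - (t * x + r * y)| ≤ (|t| + |r|) * e := by
  calc |t * a + r * b - (t * x + r * y)| = |t * (a - x) + r * (b - y)| := by ring_nf
    _ ≤ |t * (a - x)| + |r * (b - y)| := abs_add_le _ _
    _ = |t| * |a - x| + |r| * |b - y| := by rw [abs_mul, abs_mul]
    _ ≤ |t| * e + |r| * e := by gcongr
    _ = _ := by ring

theorem abs_mul_max_add_mul_min_sub_le {t r a b x y d : ℝ} (hxy : y ≤ x + 2 * d)
    (ha : |a - max x y| ≤ d) (hb : |b - min x y| ≤ d) :
    |t * a + r * b - (t * x + r * y)| ≤ (|t| + |r|) * (3 * d) := by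
  have hd := (abs_nonneg _).trans ha
  rw [abs_le] at ha hb
  apply abs_mul_add_mul_sub_le <;> rw [abs_le] <;>
    rcases le_total x y with hle | hle <;> simp only [max_eq_left, max_eq_right, min_eq_left,
      min_eq_right, hle] at ha hb <;> constructor <;> linarith

theorem abs_sub_max_le {x y z a b : ℝ} (h : |x - y| ≤ a) (hb : 0 ≤ b) (hz : z ≤ y + b) :
    |x - max y z| ≤ a + b := by
  have h1 := le_max_left y z
  have h2 : max y z ≤ y + b := max_le (by linarith) hz
  rw [abs_le] at h ⊢
  constructor <;> linarith

theorem abs_sub_min_le {x y z a b : ℝ} (h : |x - y| ≤ a) (hb : 0 ≤ b) (hz : y - b ≤ z) :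
    |x - min y z| ≤ a + b := by
  have h1 := min_le_left y z
  have h2 : y - b ≤ min y z := le_min (by linarith) hz
  rw [abs_le] at h ⊢
  constructor <;> linarith

/-- Up to subexponential factors, the singular value weights are exponentials of the maximum or
of the minimum of two additive functions, according to the sign of `A + B - s`. -/
theorem exists_nearly_multiplicative_approx (S : PCarpetIFS I) (tf tg : ℝ → ℝ) (s q : ℝ) :
    ∃ (ψ : List I → ℝ) (ε : ℕ → ℝ) (C : ℝ), Tendsto (fun n : ℕ => ε n / n) atTop (𝓝 0) ∧
      (∀ w, |ψ w| ≤ C * w.length) ∧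
      (∀ w, ∃ φ, a1U S w ^ tSel S tf tg w q * a2U S w ^ (s - tSel S tf tg w q) = Real.exp φ ∧
        |φ - ψ w| ≤ ε w.length) ∧
      ((NearlySubmul fun w => Real.exp (ψ w)) ∨ NearlySupermul fun w => Real.exp (ψ w)) := by
  have Hf := S.weaklyContracting_fst
  have Hg := S.weaklyContracting_snd
  obtain ⟨df, hdf, hf⟩ := Hf.exists_tempered_distortion
  obtain ⟨dg, hdg, hg⟩ := Hg.exists_tempered_distortion
  obtain ⟨Bf, hBf0, hBf⟩ := Hf.exists_abs_log_wDeriv_le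
  obtain ⟨Bg, hBg0, hBg⟩ := Hg.exists_abs_log_wDeriv_le
  have m0 : (0:ℝ) ∈ Icc (0:ℝ) 1 := by simp
  set d : ℕ → ℝ := fun n => |df n| + |dg n| with hd
  have hd0 : ∀ n, 0 ≤ d n := fun n => by positivity
  have hdlim : Tendsto (fun n : ℕ => d n / n) atTop (𝓝 0) := by
    simpa [hd, add_div, abs_div] using hdf.abs.add hdg.abs
  replace hf : ∀ w : List I, ∀ x ∈ Icc (0:ℝ) 1, ∀ y ∈ Icc (0:ℝ) 1,
      |Real.log (wDeriv S.f S.f' w x) - Real.log (wDeriv S.f S.f' w y)| ≤ d w.length :=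
    fun w x hx y hy => (hf w x hx y hy).trans
      ((le_abs_self _).trans (le_add_of_nonneg_right (abs_nonneg _)))
  replace hg : ∀ w : List I, ∀ x ∈ Icc (0:ℝ) 1, ∀ y ∈ Icc (0:ℝ) 1,
      |Real.log (wDeriv S.g S.g' w x) - Real.log (wDeriv S.g S.g' w y)| ≤ d w.length :=
    fun w x hx y hy => (hg w x hx y hy).trans
      ((le_abs_self _).trans (le_add_of_nonneg_left (abs_nonneg _)))
  set X : List I → ℝ := fun w => Real.log (wDeriv S.f S.f' w 0) with hX
  set Y : List I → ℝ := fun w => Real.log (wDeriv S.g S.g' w 0) with hY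
  have hX0 : X [] = 0 := by simp [hX, wDeriv]
  have hY0 : Y [] = 0 := by simp [hY, wDeriv]
  have hXapp : ∀ u v, |X (u ++ v) - (X u + X v)| ≤ d u.length := fun u v => by
    simp only [hX]
    rw [Hf.log_wDeriv_append u v m0, add_sub_add_right_eq_sub]
    exact hf u _ (Hf.mapsTo_wMap v m0) 0 m0
  have hYapp : ∀ u v, |Y (u ++ v) - (Y u + Y v)| ≤ d u.length := fun u v => by
    simp only [hY]
    rw [Hg.log_wDeriv_append u v m0, add_sub_add_right_eq_sub]
    exact hg u _ (Hg.mapsTo_wMap v m0) 0 m0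
  set A := tf q
  set B := tg q
  set M : ℝ := |A| + |s - A| + |B| + |s - B| with hM
  have hM0 : 0 ≤ M := by positivity
  have hA : |A| + |s - A| ≤ M := by linarith [abs_nonneg B, abs_nonneg (s - B)]
  have hB : |B| + |s - B| ≤ M := by linarith [abs_nonneg A, abs_nonneg (s - A)]
  set φ : List I → ℝ := fun w => tSel S tf tg w q * Real.log (a1U S w)
    + (s - tSel S tf tg w q) * Real.log (a2U S w) with hφ
  set P : List I → ℝ := fun w => A * X w + (s - A) * Y w with hP
  set Q : List I → ℝ := fun w => B * Y w + (s - B) * X w with hQ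
  have hPapp : ∀ u v, |P (u ++ v) - (P u + P v)| ≤ M * d u.length := fun u v => by
    have := abs_mul_add_mul_sub_le (t := A) (r := s - A) (hXapp u v) (hYapp u v)
    refine le_trans (le_of_eq ?_) (this.trans (mul_le_mul_of_nonneg_right hA (hd0 _)))
    simp only [hP]
    ring_nf
  have hQapp : ∀ u v, |Q (u ++ v) - (Q u + Q v)| ≤ M * d u.length := fun u v => by
    have := abs_mul_add_mul_sub_le (t := B) (r := s - B) (hYapp u v) (hXapp u v)
    refine le_trans (le_of_eq ?_) (this.trans (mul_le_mul_of_nonneg_right hB (hd0 _)))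
    simp only [hQ]
    ring_nf
  have hP0 : P [] = 0 := by simp [hP, hX0, hY0]
  have hQ0 : Q [] = 0 := by simp [hQ, hX0, hY0]
  have hPbd : ∀ w, |P w| ≤ M * (Bf + Bg) * w.length := fun w => by
    have := abs_mul_add_mul_sub_le (t := A) (r := s - A) (a := X w) (b := Y w) (x := 0) (y := 0)
      (e := (Bf + Bg) * w.length)
      (by rw [sub_zero]; exact (hBf w 0 m0).trans (by gcongr; linarith))
      (by rw [sub_zero]; exact (hBg w 0 m0).trans (by gcongr; linarith))
    rw [mul_zero, mul_zero, add_zero, sub_zero] at this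
    rw [mul_assoc]
    exact this.trans (by gcongr)
  have hQbd : ∀ w, |Q w| ≤ M * (Bf + Bg) * w.length := fun w => by
    have := abs_mul_add_mul_sub_le (t := B) (r := s - B) (a := Y w) (b := X w) (x := 0) (y := 0)
      (e := (Bf + Bg) * w.length)
      (by rw [sub_zero]; exact (hBg w 0 m0).trans (by gcongr; linarith))
      (by rw [sub_zero]; exact (hBf w 0 m0).trans (by gcongr; linarith))
    rw [mul_zero, mul_zero, add_zero, sub_zero] at this
    rw [mul_assoc]
    exact this.trans (by gcongr)
  have hφeq : ∀ w, a1U S w ^ tSel S tf tg w q * a2U S w ^ (s - tSel S tf tg w q)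
      = Real.exp (φ w) := fun w => by
    have h1 := abs_log_a1U_sub_le S w (fun z hz => hf w z hz 0 m0) (fun z hz => hg w z hz 0 m0)
    have h2 := abs_log_a2U_sub_le S w (fun z hz => hf w z hz 0 m0) (fun z hz => hg w z hz 0 m0)
    rw [Real.rpow_def_of_pos h1.1, Real.rpow_def_of_pos h2.1, ← Real.exp_add]
    simp only [hφ, mul_comm]
  have hφcases : ∀ w, (|φ w - P w| ≤ M * (3 * d w.length) ∧ Y w ≤ X w + 2 * d w.length) ∨
      (|φ w - Q w| ≤ M * (3 * d w.length) ∧ X w ≤ Y w + 2 * d w.length) := fun w => by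
    have h1 := (abs_log_a1U_sub_le S w (fun z hz => hf w z hz 0 m0)
      (fun z hz => hg w z hz 0 m0)).2
    have h2 := (abs_log_a2U_sub_le S w (fun z hz => hf w z hz 0 m0)
      (fun z hz => hg w z hz 0 m0)).2
    have hdiamf := Hf.abs_log_diam_sub_le w (hf w)
    have hdiamg := Hg.abs_log_diam_sub_le w (hg w)
    have h3d : 0 ≤ 3 * d w.length := by linarith [hd0 w.length]
    simp only [hφ, tSel]
    split_ifs with hle
    · left
      have hexp := Real.exp_le_exp.1 (hdiamg.1.trans (hle.trans hdiamf.2))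
      have hYX : Y w ≤ X w + 2 * d w.length := by simp only [hX, hY]; linarith
      exact ⟨(abs_mul_max_add_mul_min_sub_le hYX h1 h2).trans
        (mul_le_mul_of_nonneg_right hA h3d), hYX⟩
    · right
      have hexp := Real.exp_le_exp.1 (hdiamf.1.trans ((not_le.1 hle).le.trans hdiamg.2))
      have hXY : X w ≤ Y w + 2 * d w.length := by simp only [hX, hY]; linarith
      rw [max_comm] at h1
      rw [min_comm] at h2
      exact ⟨(abs_mul_max_add_mul_min_sub_le hXY h1 h2).trans
        (mul_le_mul_of_nonneg_right hB h3d), hXY⟩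
  have hPQ : ∀ w, P w - Q w = (A + B - s) * (X w - Y w) := fun w => by
    simp only [hP, hQ]
    ring
  have hlimM : Tendsto (fun n : ℕ => M * d n / n) atTop (𝓝 0) := by
    simpa [mul_div_assoc] using hdlim.const_mul M
  have hlimK : Tendsto (fun n : ℕ => (3 * M + 2 * |A + B - s|) * d n / n) atTop (𝓝 0) := by
    simpa [mul_div_assoc] using hdlim.const_mul (3 * M + 2 * |A + B - s|)
  rcases le_total 0 (A + B - s) with hs | hs
  · refine ⟨fun w => max (P w) (Q w), _, M * (Bf + Bg), hlimK, fun w => ?_,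
      fun w => ⟨φ w, hφeq w, ?_⟩,
      Or.inl (nearlySubmul_exp hlimM (by simp [hP0, hQ0]) fun u v => ?_)⟩
    · have h1 := abs_le.1 (hPbd w)
      have h2 := abs_le.1 (hQbd w)
      rw [abs_le]
      exact ⟨le_max_of_le_left h1.1, max_le h1.2 h2.2⟩
    · have h2d := mul_nonneg hs (by linarith [hd0 w.length] : 0 ≤ 2 * d w.length)
      have hK : (3 * M + 2 * |A + B - s|) * d w.length
          = M * (3 * d w.length) + (A + B - s) * (2 * d w.length) := by
        rw [abs_of_nonneg hs]
        ring
      rw [hK]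
      rcases hφcases w with ⟨h, hle⟩ | ⟨h, hle⟩
      · have hm := mul_le_mul_of_nonneg_left (sub_le_iff_le_add'.2 hle) hs
        exact abs_sub_max_le h h2d (by linarith [hPQ w])
      · have hm := mul_le_mul_of_nonneg_left (sub_le_iff_le_add'.2 hle) hs
        dsimp only
        rw [max_comm]
        exact abs_sub_max_le h h2d (by linarith [hPQ w])
    · have h1 := abs_le.1 (hPapp u v)
      have h2 := abs_le.1 (hQapp u v)
      refine max_le ?_ ?_
      · linarith [le_max_left (P u) (Q u), le_max_left (P v) (Q v)]
      · linarith [le_max_right (P u) (Q u), le_max_right (P v) (Q v)]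
  · refine ⟨fun w => min (P w) (Q w), _, M * (Bf + Bg), hlimK, fun w => ?_,
      fun w => ⟨φ w, hφeq w, ?_⟩,
      Or.inr (nearlySupermul_exp hlimM (by simp [hP0, hQ0]) fun u v => ?_)⟩
    · have h1 := abs_le.1 (hPbd w)
      have h2 := abs_le.1 (hQbd w)
      rw [abs_le]
      exact ⟨le_min h1.1 h2.1, min_le_of_left_le h1.2⟩
    · have hs' := neg_nonneg.2 hs
      have h2d := mul_nonneg hs' (by linarith [hd0 w.length] : 0 ≤ 2 * d w.length)
      have hK : (3 * M + 2 * |A + B - s|) * d w.length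
          = M * (3 * d w.length) + -(A + B - s) * (2 * d w.length) := by
        rw [abs_of_nonpos hs]
        ring
      rw [hK]
      rcases hφcases w with ⟨h, hle⟩ | ⟨h, hle⟩
      · have hm := mul_le_mul_of_nonneg_left (sub_le_iff_le_add'.2 hle) hs'
        exact abs_sub_min_le h h2d (by linarith [hPQ w])
      · have hm := mul_le_mul_of_nonneg_left (sub_le_iff_le_add'.2 hle) hs'
        dsimp only
        rw [min_comm]
        exact abs_sub_min_le h h2d (by linarith [hPQ w])
    · have h1 := abs_le.1 (hPapp u v)
      have h2 := abs_le.1 (hQapp u v)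
      refine le_min ?_ ?_
      · linarith [min_le_left (P u) (Q u), min_le_left (P v) (Q v)]
      · linarith [min_le_right (P u) (Q u), min_le_right (P v) (Q v)]

/-- Some cylinder of each length carries at least the average mass. -/
theorem exists_exp_le_measure_cyl [MeasurableSpace I] [Nonempty I] (P : Measure (ℕ → I))
    [IsProbabilityMeasure P] (n : ℕ) :
    ∃ w : Fin n → I,
      Real.exp (-(Real.log (Fintype.card I) * n)) ≤ (P (cyl (List.ofFn w))).toReal := by
  have hcard : (0:ℝ) < Fintype.card I := by exact_mod_cast Fintype.card_pos
  by_contra! hcon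
  have hcover : (univ : Set (ℕ → I)) ⊆ ⋃ w : Fin n → I, cyl (List.ofFn w) := fun ω _ =>
    mem_iUnion.2 ⟨fun k => ω k, fun k => by simp⟩
  have h1 : (1:ℝ) ≤ ∑ w : Fin n → I, (P (cyl (List.ofFn w))).toReal := by
    rw [← ENNReal.toReal_sum fun w _ => measure_ne_top P _, ← ENNReal.toReal_one]
    refine ENNReal.toReal_mono (ENNReal.sum_ne_top.2 fun w _ => measure_ne_top P _) ?_
    rw [← measure_univ (μ := P), ← tsum_fintype (L := .unconditional _)]
    exact (measure_mono hcover).trans (measure_iUnion_le _)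
  have h2 := Finset.sum_lt_sum_of_nonempty (s := Finset.univ) Finset.univ_nonempty
    fun w _ => hcon w
  rw [Finset.sum_const, Finset.card_univ, Fintype.card_fun, Fintype.card_fin, nsmul_eq_mul,
    Nat.cast_pow, Real.exp_neg, mul_comm (Real.log _), Real.exp_nat_mul, Real.exp_log hcard,
    mul_inv_cancel₀ (pow_pos hcard n).ne'] at h2
  linarith

/-- For an almost quasi-Bernoulli measure on a parabolic carpet with the
summability conditions on the induced system, the carpet pressure
`P(s,q) = lim_n (∑_{i ∈ Iⁿ} ℙ([i])^q ᾱ₁(i)^{t(i,q)} ᾱ₂(i)^{s - t(i,q)})^{1/n}` exists for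
every `s ∈ ℝ` and `q ≥ 0`. -/
theorem carpet_pressure_exists {I : Type} [Fintype I] [MeasurableSpace I]
    [MeasurableSingletonClass I]
    (S : PCarpetIFS I) (i0 : I)
    (hi0 : a1U S [i0] < 1)
    (hsumf : Summable fun φ : ↥((fun w : List I => wMap S.f w) '' Iinf i0) =>
      Metric.diam ((φ : ℝ → ℝ) '' Icc (0:ℝ) 1) ^ S.αf)
    (hsumg : Summable fun φ : ↥((fun w : List I => wMap S.g w) '' Iinf i0) =>
      Metric.diam ((φ : ℝ → ℝ) '' Icc (0:ℝ) 1) ^ S.αg)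
    (P : Measure (ℕ → I)) [IsProbabilityMeasure P]
    (hwqb : WeakQB P) (hqb : QBonInf P i0)
    (Pi : (ℕ → I) → ℝ × ℝ)
    (hPi : ∀ ω : ℕ → I,
      (⋂ n : ℕ, SMap S (List.ofFn fun k : Fin n => ω k) '' (Icc (0:ℝ) 1 ×ˢ Icc (0:ℝ) 1))
        = {Pi ω})
    (hPiM : Measurable Pi)
    (tf tg : ℝ → ℝ)
    (htf : ∀ q : ℝ, 0 ≤ q →
      Tendsto (fun δ : ℝ => Real.log (Dq1 (P.map fun ω => (Pi ω).1) q δ) / (-Real.log δ))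
        (𝓝[>] (0:ℝ)) (𝓝 (tf q)))
    (htg : ∀ q : ℝ, 0 ≤ q →
      Tendsto (fun δ : ℝ => Real.log (Dq1 (P.map fun ω => (Pi ω).2) q δ) / (-Real.log δ))
        (𝓝[>] (0:ℝ)) (𝓝 (tg q))) :
    ∀ s q : ℝ, 0 ≤ q →
      ∃ L : ℝ, Tendsto (fun n : ℕ => cSum P S tf tg n s q ^ ((n : ℝ)⁻¹)) atTop (𝓝 L) := by
  intro s q hq
  obtain ⟨ψ, ε, C, hε, hψ, hterm, hmul⟩ := exists_nearly_multiplicative_approx S tf tg s q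
  have : Nonempty I := ⟨i0⟩
  have hcard : (0:ℝ) < Fintype.card I := by exact_mod_cast Fintype.card_pos
  set p : List I → ℝ := fun w => (P (cyl w)).toReal
  have hp0 : ∀ w, 0 ≤ p w := fun w => ENNReal.toReal_nonneg
  have hp1 : ∀ w, p w ≤ 1 := fun w => by
    simpa using ENNReal.toReal_mono ENNReal.one_ne_top (prob_le_one (μ := P) (s := cyl w))
  have hpq0 : ∀ w, 0 ≤ p w ^ q := fun w => Real.rpow_nonneg (hp0 w) q
  set W : List I → ℝ := fun w => p w ^ q * Real.exp (ψ w) with hW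
  have hW0 : ∀ w, 0 ≤ W w := fun w => mul_nonneg (hpq0 w) (Real.exp_nonneg _)
  have hlow : ∀ n : ℕ, Real.exp (-((Real.log (Fintype.card I) * q + C) * n))
      ≤ ∑ w : Fin n → I, W (List.ofFn w) := fun n => by
    obtain ⟨w, hw⟩ := exists_exp_le_measure_cyl P n
    refine le_trans ?_ (Finset.single_le_sum (f := fun w : Fin n → I => W (List.ofFn w))
      (fun w _ => hW0 _) (Finset.mem_univ w))
    have hψw := (abs_le.1 (hψ (List.ofFn w))).1
    rw [List.length_ofFn] at hψw
    calc _ = Real.exp (-(Real.log (Fintype.card I) * n)) ^ q * Real.exp (-(C * n)) := by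
          rw [← Real.exp_mul, ← Real.exp_add]
          ring_nf
      _ ≤ _ := mul_le_mul (Real.rpow_le_rpow (Real.exp_nonneg _) hw hq)
          (Real.exp_le_exp.2 hψw) (Real.exp_nonneg _) (hpq0 _)
  have hup : ∀ n : ℕ, ∑ w : Fin n → I, W (List.ofFn w)
      ≤ Real.exp ((Real.log (Fintype.card I) + C) * n) := fun n => by
    have hle : ∀ w : Fin n → I, W (List.ofFn w) ≤ Real.exp (C * n) := fun w => by
      have hψw := (abs_le.1 (hψ (List.ofFn w))).2
      rw [List.length_ofFn] at hψw
      exact (mul_le_of_le_one_left (Real.exp_nonneg _)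
        (Real.rpow_le_one (hp0 _) (hp1 _) hq)).trans (Real.exp_le_exp.2 hψw)
    refine (Finset.sum_le_sum fun w _ => hle w).trans_eq ?_
    rw [Finset.sum_const, Finset.card_univ, Fintype.card_fun, Fintype.card_fin, nsmul_eq_mul,
      Nat.cast_pow, add_mul, Real.exp_add, mul_comm (Real.log _), Real.exp_nat_mul,
      Real.exp_log hcard]
  have hZpos : ∀ n : ℕ, 0 < ∑ w : Fin n → I, W (List.ofFn w) :=
    fun n => (Real.exp_pos _).trans_le (hlow n)
  obtain ⟨hPsub, hPsup⟩ := hwqb.nearlySubmul_and_nearlySupermul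
  obtain ⟨L, hL⟩ : ∃ L, Tendsto
      (fun n : ℕ => Real.log (∑ w : Fin n → I, W (List.ofFn w)) / n) atTop (𝓝 L) := by
    rcases hmul with hsub | hsup
    · exact ((hPsub.rpow hp0 hq).mul hsub hpq0 fun w => Real.exp_nonneg _).exists_tendsto
        hW0 hlow
    · exact ((hPsup.rpow hp0 hq).mul hsup hpq0 fun w => Real.exp_nonneg _).exists_tendsto
        hW0 hZpos hup
  have hlowc : ∀ n : ℕ, Real.exp (-ε n) * ∑ w : Fin n → I, W (List.ofFn w)
      ≤ cSum P S tf tg n s q := fun n => by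
    rw [cSum, Finset.mul_sum]
    refine Finset.sum_le_sum fun w _ => ?_
    obtain ⟨φ, hφ, hd⟩ := hterm (List.ofFn w)
    rw [List.length_ofFn] at hd
    rw [mul_assoc ((P (cyl (List.ofFn w))).toReal ^ q), hφ, mul_left_comm, ← Real.exp_add]
    exact mul_le_mul_of_nonneg_left (Real.exp_le_exp.2 (by linarith [(abs_le.1 hd).1])) (hpq0 _)
  have hupc : ∀ n : ℕ, cSum P S tf tg n s q
      ≤ Real.exp (ε n) * ∑ w : Fin n → I, W (List.ofFn w) := fun n => by
    rw [cSum, Finset.mul_sum]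
    refine Finset.sum_le_sum fun w _ => ?_
    obtain ⟨φ, hφ, hd⟩ := hterm (List.ofFn w)
    rw [List.length_ofFn] at hd
    rw [mul_assoc ((P (cyl (List.ofFn w))).toReal ^ q), hφ, mul_left_comm, ← Real.exp_add]
    exact mul_le_mul_of_nonneg_left (Real.exp_le_exp.2 (by linarith [(abs_le.1 hd).2])) (hpq0 _)
  have hcpos : ∀ n : ℕ, 0 < cSum P S tf tg n s q := fun n =>
    (mul_pos (Real.exp_pos _) (hZpos n)).trans_le (hlowc n)
  have hlog : Tendsto (fun n : ℕ => Real.log (cSum P S tf tg n s q) / n) atTop (𝓝 L) := by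
    refine tendsto_of_tendsto_of_tendsto_of_le_of_le (by simpa using hL.sub hε)
      (by simpa using hL.add hε) (fun n => ?_) (fun n => ?_)
    · have := Real.log_le_log (mul_pos (Real.exp_pos _) (hZpos n)) (hlowc n)
      rw [Real.log_mul (Real.exp_ne_zero _) (hZpos n).ne', Real.log_exp] at this
      simp only [← sub_div]
      gcongr
      linarith
    · have := Real.log_le_log (hcpos n) (hupc n)
      rw [Real.log_mul (Real.exp_ne_zero _) (hZpos n).ne', Real.log_exp] at this
      simp only [← add_div]
      gcongr
      linarith
  refine ⟨Real.exp L, ((Real.continuous_exp.tendsto L).comp hlog).congr fun n => ?_⟩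
  rw [Real.rpow_def_of_pos (hcpos n), Function.comp, div_eq_mul_inv]
end

section
/- Let μ = ℙ∘Π^{-1} be an almost quasi-Bernoulli measure on a parabolic carpet satisfying ∑_{i∈I_∞} |f_i([0,1])|^{α_f} < ∞ and ∑_{i∈I_∞} |g_i([0,1])|^{α_g} < ∞. Then P(2,q) ≤ 1 for all q ≥ 0, where P(s,q) := lim_{n→∞} (∑_{i∈I^n} ℙ([i])^q ᾱ₁(i)^{t(i,q)} ᾱ₂(i)^{s−t(i,q)})^{1/n}. -/
open Set Filter MeasureTheory Metric Topology
open scoped ENNReal NNReal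

variable {I : Type} [Fintype I]

namespace ParabolicIFS

/-- Word maps of self-maps of `[0,1]` are self-maps of `[0,1]`. -/
lemma wMap_mem {I : Type} {h : I → ℝ → ℝ} {s : Set ℝ} (maps : ∀ i, MapsTo (h i) s s)
    (w : List I) : MapsTo (wMap h w) s s := by
  induction w with
  | nil => exact fun x hx => hx
  | cons a t ih => exact fun x hx => maps a (ih hx)

lemma wMap_hasDeriv {I : Type} {h h' : I → ℝ → ℝ} {s : Set ℝ} (maps : ∀ i, MapsTo (h i) s s)
    (hd : ∀ i, ∀ x ∈ s, HasDerivWithinAt (h i) (h' i x) s x)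
    (w : List I) : ∀ x ∈ s, HasDerivWithinAt (wMap h w) (wDeriv h h' w x) s x := by
  induction w with
  | nil => exact fun x _ => hasDerivWithinAt_id x s
  | cons a t ih =>
    intro x hx
    exact (hd a _ (wMap_mem maps t hx)).comp x (ih x hx) (wMap_mem maps t)

lemma wDeriv_ne_zero {I : Type} {h h' : I → ℝ → ℝ} {s : Set ℝ} (maps : ∀ i, MapsTo (h i) s s)
    (hn : ∀ i, ∀ x ∈ s, h' i x ≠ 0) (w : List I) : ∀ x ∈ s, wDeriv h h' w x ≠ 0 := by
  induction w with
  | nil => exact fun x _ => one_ne_zero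
  | cons a t ih =>
    exact fun x hx => mul_ne_zero (hn a _ (wMap_mem maps t hx)) (ih x hx)

/-- The images of `[0,1]` under long words are uniformly small. -/
lemma exists_length_wMap_dist_le {I : Type} [Finite I] {h : I → ℝ → ℝ}
    (maps : ∀ i, MapsTo (h i) (Icc (0:ℝ) 1) (Icc (0:ℝ) 1))
    (hc : ∀ i, ContinuousOn (h i) (Icc (0:ℝ) 1))
    (contract : ∀ i, ∀ x ∈ Icc (0:ℝ) 1, ∀ y ∈ Icc (0:ℝ) 1, x ≠ y → |h i x - h i y| < |x - y|)
    {ε : ℝ} (hε : 0 < ε) :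
    ∃ N : ℕ, ∀ w : List I, N ≤ w.length → ∀ x ∈ Icc (0:ℝ) 1, ∀ y ∈ Icc (0:ℝ) 1,
      |wMap h w x - wMap h w y| ≤ ε := by
  have gap : ∀ i, ∀ᶠ δ in 𝓝[>] (0:ℝ), ∀ x ∈ Icc (0:ℝ) 1, ∀ y ∈ Icc (0:ℝ) 1, ε ≤ |x - y| →
      |h i x - h i y| ≤ |x - y| - δ := by
    intro i
    set K : Set (ℝ × ℝ) := (Icc (0:ℝ) 1 ×ˢ Icc (0:ℝ) 1) ∩ {p | ε ≤ |p.1 - p.2|}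
    have hK : IsCompact K := (isCompact_Icc.prod isCompact_Icc).inter_right
      (isClosed_le continuous_const (by fun_prop))
    have hcont : ContinuousOn (fun p : ℝ × ℝ => |p.1 - p.2| - |h i p.1 - h i p.2|) K := by
      have h1 : ContinuousOn (fun p : ℝ × ℝ => h i p.1) K :=
        (hc i).comp continuousOn_fst fun p hp => hp.1.1
      have h2 : ContinuousOn (fun p : ℝ × ℝ => h i p.2) K :=
        (hc i).comp continuousOn_snd fun p hp => hp.1.2
      have h3 : ContinuousOn (fun p : ℝ × ℝ => |p.1 - p.2|) K := by fun_prop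
      exact h3.sub (h1.sub h2).abs
    have : ∃ δ > 0, ∀ p ∈ K, δ ≤ |p.1 - p.2| - |h i p.1 - h i p.2| := by
      rcases K.eq_empty_or_nonempty with hE | hE
      · exact ⟨1, one_pos, by simp [hE]⟩
      · obtain ⟨p, hp, hmin⟩ := hK.exists_isMinOn hE hcont
        refine ⟨_, sub_pos.2 (contract i _ hp.1.1 _ hp.1.2 ?_), fun z hz => hmin hz⟩
        intro he
        have := hp.2
        simp [he] at this
        linarith
    obtain ⟨δ, hδ, hmin⟩ := this
    filter_upwards [Ioc_mem_nhdsGT hδ] with r hr x hx y hy hxy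
    have := hmin (x, y) ⟨⟨hx, hy⟩, hxy⟩
    simp only at this
    linarith [hr.2]
  obtain ⟨δ, hgap, hδ⟩ := ((eventually_all.2 gap).and self_mem_nhdsWithin).exists
  have hδ : 0 < δ := hδ
  have key : ∀ w : List I, ∀ x ∈ Icc (0:ℝ) 1, ∀ y ∈ Icc (0:ℝ) 1,
      |wMap h w x - wMap h w y| ≤ max ε (1 - w.length * δ) := by
    intro w x hx y hy
    induction w with
    | nil =>
      refine le_max_of_le_right ?_
      simp only [wMap, id, List.length_nil, Nat.cast_zero, zero_mul, sub_zero]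
      exact abs_le.2 ⟨by linarith [hx.1, hy.2], by linarith [hx.2, hy.1]⟩
    | cons a t ih =>
      have hx' := wMap_mem maps t hx
      have hy' := wMap_mem maps t hy
      simp only [wMap, List.length_cons, Nat.cast_add, Nat.cast_one]
      by_cases hcase : ε ≤ |wMap h t x - wMap h t y|
      · have h1 := hgap a _ hx' _ hy' hcase
        rcases le_max_iff.1 ih with h2 | h2
        · exact le_max_of_le_left (by simp only [Function.comp]; linarith)
        · exact le_max_of_le_right (by simp only [Function.comp]; linarith)
      · refine le_max_of_le_left (le_trans ?_ (not_le.1 hcase).le)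
        by_cases he : wMap h t x = wMap h t y
        · simp [he]
        · exact (contract a _ hx' _ hy' he).le
  obtain ⟨N, hN⟩ := exists_nat_ge (1 / δ)
  refine ⟨N, fun w hw x hx y hy => (key w x hx y hy).trans (max_le le_rfl ?_)⟩
  rw [div_le_iff₀ hδ] at hN
  have : (N : ℝ) * δ ≤ w.length * δ := by gcongr
  linarith

/-- Subexponential distortion: the derivative along a word is comparable with the length of the
image of `[0,1]`, up to a factor growing at an arbitrarily small exponential rate. -/
lemma exists_abs_wDeriv_le {I : Type} [Finite I] {h h' : I → ℝ → ℝ}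
    (maps : ∀ i, MapsTo (h i) (Icc (0:ℝ) 1) (Icc (0:ℝ) 1))
    (contract : ∀ i, ∀ x ∈ Icc (0:ℝ) 1, ∀ y ∈ Icc (0:ℝ) 1, x ≠ y → |h i x - h i y| < |x - y|)
    (hd : ∀ i, ∀ x ∈ Icc (0:ℝ) 1, HasDerivWithinAt (h i) (h' i x) (Icc (0:ℝ) 1) x)
    (hc' : ∀ i, ContinuousOn (h' i) (Icc (0:ℝ) 1))
    (hn : ∀ i, ∀ x ∈ Icc (0:ℝ) 1, h' i x ≠ 0) {η : ℝ} (hη : 0 < η) :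
    ∃ K : ℝ, 0 < K ∧ ∀ w : List I, ∀ x ∈ Icc (0:ℝ) 1,
      |wDeriv h h' w x| ≤ K * Real.exp (η * w.length) * |wMap h w 1 - wMap h w 0| := by
  have hc : ∀ i, ContinuousOn (h i) (Icc (0:ℝ) 1) := fun i x hx => (hd i x hx).continuousWithinAt
  have hlog : ∀ i, ContinuousOn (fun x => Real.log |h' i x|) (Icc (0:ℝ) 1) := fun i =>
    (hc' i).abs.log fun x hx => abs_ne_zero.2 (hn i x hx)
  have ratio : ∀ i, ∀ x ∈ Icc (0:ℝ) 1, ∀ y ∈ Icc (0:ℝ) 1, ∀ r : ℝ,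
      Real.log |h' i x| - Real.log |h' i y| ≤ r → |h' i x| ≤ Real.exp r * |h' i y| := by
    intro i x hx y hy r hr
    have hx0 := abs_pos.2 (hn i x hx)
    have hy0 := abs_pos.2 (hn i y hy)
    calc |h' i x| = Real.exp (Real.log |h' i x|) := (Real.exp_log hx0).symm
      _ ≤ Real.exp (r + Real.log |h' i y|) := Real.exp_le_exp.2 (by linarith)
      _ = _ := by rw [Real.exp_add, Real.exp_log hy0]
  have coarse : ∀ i, ∀ᶠ A in (atTop : Filter ℝ), ∀ x ∈ Icc (0:ℝ) 1, ∀ y ∈ Icc (0:ℝ) 1,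
      |h' i x| ≤ Real.exp A * |h' i y| := by
    intro i
    obtain ⟨B, hB⟩ := isCompact_Icc.exists_bound_of_continuousOn (hlog i)
    filter_upwards [eventually_ge_atTop (2 * B)] with A hA x hx y hy
    refine ratio i x hx y hy A ?_
    have h1 := abs_le.1 (hB x hx)
    have h2 := abs_le.1 (hB y hy)
    linarith [h1.2, h2.1]
  have fine : ∀ i, ∀ᶠ ε in 𝓝[>] (0:ℝ), ∀ x ∈ Icc (0:ℝ) 1, ∀ y ∈ Icc (0:ℝ) 1, |x - y| ≤ ε →
      |h' i x| ≤ Real.exp η * |h' i y| := by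
    intro i
    have hu := isCompact_Icc.uniformContinuousOn_of_continuous (hlog i)
    obtain ⟨ε, hε, hu⟩ := Metric.uniformContinuousOn_iff.1 hu η hη
    filter_upwards [Ioo_mem_nhdsGT hε] with r hr x hx y hy hxy
    refine ratio i x hx y hy η ?_
    have := hu x hx y hy (by rw [Real.dist_eq]; exact hxy.trans_lt hr.2)
    rw [Real.dist_eq] at this
    exact (le_abs_self _).trans this.le
  obtain ⟨A, hA, hA0⟩ := ((eventually_all.2 coarse).and (eventually_ge_atTop 0)).exists
  obtain ⟨ε, hfine, hε⟩ := ((eventually_all.2 fine).and self_mem_nhdsWithin).exists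
  obtain ⟨N, hN⟩ := exists_length_wMap_dist_le maps hc contract hε
  have dist : ∀ w : List I, ∀ x ∈ Icc (0:ℝ) 1, ∀ y ∈ Icc (0:ℝ) 1,
      |wDeriv h h' w x| ≤
        Real.exp A ^ min w.length N * Real.exp (η * w.length) * |wDeriv h h' w y| := by
    intro w x hx y hy
    induction w with
    | nil => simp [wDeriv]
    | cons a t ih =>
      have hx' := wMap_mem maps t hx
      have hy' := wMap_mem maps t hy
      simp only [wDeriv, abs_mul, List.length_cons, Nat.cast_add, Nat.cast_one, mul_add, mul_one,
        Real.exp_add]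
      by_cases hcase : N ≤ t.length
      · have h1 := hfine a _ hx' _ hy' (hN t hcase x hx y hy)
        rw [min_eq_right hcase] at ih
        rw [min_eq_right (by omega)]
        calc _ ≤ (Real.exp η * |h' a (wMap h t y)|) *
              (Real.exp A ^ N * Real.exp (η * t.length) * |wDeriv h h' t y|) := by gcongr
          _ = _ := by ring
      · have h1 := hA a _ hx' _ hy'
        rw [min_eq_left (by omega)] at ih
        rw [min_eq_left (by omega)]
        calc _ ≤ (Real.exp A * |h' a (wMap h t y)|) *
              (Real.exp A ^ t.length * Real.exp (η * t.length) * |wDeriv h h' t y|) := by gcongr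
          _ = Real.exp A ^ (t.length + 1) * (Real.exp (η * t.length) * 1) *
              (|h' a (wMap h t y)| * |wDeriv h h' t y|) := by ring
          _ ≤ _ := by
            gcongr
            exact Real.one_le_exp hη.le
  refine ⟨Real.exp A ^ N, by positivity, fun w x hx => ?_⟩
  have hdw := wMap_hasDeriv maps hd w
  obtain ⟨c, hcm, hceq⟩ := exists_hasDerivAt_eq_slope (wMap h w) (wDeriv h h' w) zero_lt_one
    (fun z hz => (hdw z hz).continuousWithinAt)
    (fun z hz => (hdw z (Ioo_subset_Icc_self hz)).hasDerivAt (Icc_mem_nhds hz.1 hz.2))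
  rw [sub_zero, div_one] at hceq
  rw [← hceq]
  refine (dist w x hx c (Ioo_subset_Icc_self hcm)).trans ?_
  gcongr
  · exact Real.one_le_exp hA0
  · exact min_le_right _ _

/-- A self-map of `[0,1]` with nonvanishing derivative preserves the open interval. -/
lemma mapsTo_Ioo {h h' : ℝ → ℝ} (maps : MapsTo h (Icc (0:ℝ) 1) (Icc (0:ℝ) 1))
    (hd : ∀ x ∈ Icc (0:ℝ) 1, HasDerivWithinAt h (h' x) (Icc (0:ℝ) 1) x)
    (hn : ∀ x ∈ Icc (0:ℝ) 1, h' x ≠ 0) : MapsTo h (Ioo (0:ℝ) 1) (Ioo (0:ℝ) 1) := by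
  intro x hx
  have hxI := Ioo_subset_Icc_self hx
  have hnhds : Icc (0:ℝ) 1 ∈ 𝓝 x := Icc_mem_nhds hx.1 hx.2
  have hdx := (hd x hxI).hasDerivAt hnhds
  refine ⟨lt_of_le_of_ne (maps hxI).1 fun h0 => ?_, lt_of_le_of_ne (maps hxI).2 fun h1 => ?_⟩
  · refine hn x hxI (IsLocalMin.hasDerivAt_eq_zero ?_ hdx)
    filter_upwards [hnhds] with y hy
    rw [← h0]
    exact (maps hy).1
  · refine hn x hxI (IsLocalMax.hasDerivAt_eq_zero ?_ hdx)
    filter_upwards [hnhds] with y hy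
    rw [h1]
    exact (maps hy).2

/-- A function with nonvanishing derivative on `[0,1]` is injective there. -/
lemma injOn_Icc {h h' : ℝ → ℝ}
    (hd : ∀ x ∈ Icc (0:ℝ) 1, HasDerivWithinAt h (h' x) (Icc (0:ℝ) 1) x)
    (hn : ∀ x ∈ Icc (0:ℝ) 1, h' x ≠ 0) : InjOn h (Icc (0:ℝ) 1) := by
  have aux : ∀ x ∈ Icc (0:ℝ) 1, ∀ y ∈ Icc (0:ℝ) 1, x < y → h x ≠ h y := by
    intro x hx y hy hxy heq
    have hsub : Icc x y ⊆ Icc (0:ℝ) 1 := Icc_subset_Icc hx.1 hy.2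
    obtain ⟨c, hc, hc0⟩ := exists_hasDerivAt_eq_zero (f' := h') hxy
      (fun z hz => (hd z (hsub hz)).continuousWithinAt.mono hsub) heq
      (fun z hz => (hd z (hsub (Ioo_subset_Icc_self hz))).hasDerivAt
        (Icc_mem_nhds (hx.1.trans_lt hz.1) (hz.2.trans_le hy.2)))
    exact hn c (hsub (Ioo_subset_Icc_self hc)) hc0
  intro x hx y hy heq
  rcases lt_trichotomy x y with hlt | he | hgt
  · exact (aux x hx y hy hlt heq).elim
  · exact he
  · exact (aux y hy x hx hgt heq.symm).elim

/-- The open interval spanned by the values at the endpoints lies in the image of `(0,1)`. -/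
lemma Ioo_min_max_subset_image {h : ℝ → ℝ} (hc : ContinuousOn h (Icc (0:ℝ) 1)) :
    Ioo (min (h 0) (h 1)) (max (h 0) (h 1)) ⊆ h '' Ioo (0:ℝ) 1 := by
  rcases le_total (h 0) (h 1) with hle | hle
  · rw [min_eq_left hle, max_eq_right hle]
    exact intermediate_value_Ioo zero_le_one hc
  · rw [min_eq_right hle, max_eq_left hle]
    exact intermediate_value_Ioo' zero_le_one hc

lemma continuousOn_of_abs_sub_le_rpow {k : ℝ → ℝ} {s : Set ℝ} {C α : ℝ} (hα : 0 < α)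
    (hk : ∀ x ∈ s, ∀ y ∈ s, |k x - k y| ≤ C * |x - y| ^ α) : ContinuousOn k s := by
  intro x hx
  refine tendsto_iff_dist_tendsto_zero.2 ?_
  have hlim : Tendsto (fun y => C * |y - x| ^ α) (𝓝[s] x) (𝓝 0) := by
    have : ContinuousAt (fun y => C * |y - x| ^ α) x := by
      refine continuousAt_const.mul (ContinuousAt.rpow_const (by fun_prop) (Or.inr hα.le))
    have h0 := this.tendsto
    simp only [sub_self, abs_zero, Real.zero_rpow hα.ne', mul_zero] at h0
    exact h0.mono_left nhdsWithin_le_nhds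
  refine squeeze_zero' (Eventually.of_forall fun y => dist_nonneg) ?_ hlim
  filter_upwards [self_mem_nhdsWithin] with y hy
  exact hk y hy x hx

/-- A moment sum of a probability measure on `[0,1]` is at most the number of relevant mesh
intervals. -/
lemma Dq1_le {ν : Measure ℝ} [IsProbabilityMeasure ν] (hν : ν (Icc (0:ℝ) 1)ᶜ = 0)
    {q δ : ℝ} (hq : 0 ≤ q) (hδ : 0 < δ) (hδ1 : δ ≤ 1) : Dq1 ν q δ ≤ 3 / δ := by
  have hpw : ∀ a : ℝ, 0 ≤ a → a ≤ 1 → pw a q ≤ 1 := by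
    intro a h0 h1
    unfold pw
    split_ifs
    · exact zero_le_one
    · exact Real.rpow_le_one h0 h1 hq
  unfold Dq1
  rw [tsum_eq_sum (s := Finset.Icc (-1) ⌊1 / δ⌋)]
  · calc _ ≤ ∑ k ∈ Finset.Icc (-1) ⌊1 / δ⌋, (1:ℝ) := by
          refine Finset.sum_le_sum fun k _ => hpw _ ENNReal.toReal_nonneg ?_
          exact ENNReal.toReal_le_of_le_ofReal zero_le_one (by simpa using prob_le_one)
      _ = ((⌊1 / δ⌋ + 2 : ℤ) : ℝ) := by
          have hfl : 0 ≤ ⌊1 / δ⌋ := Int.floor_nonneg.2 (by positivity)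
          rw [Finset.sum_const, nsmul_eq_mul, mul_one, Int.card_Icc]
          have : ((⌊1 / δ⌋ + 1 - -1).toNat : ℤ) = ⌊1 / δ⌋ + 2 := by omega
          exact_mod_cast this
      _ ≤ 3 / δ := by
          push_cast
          have h1 := Int.floor_le (1 / δ)
          have h2 : 1 ≤ 1 / δ := (one_le_div hδ).2 hδ1
          have h3 : 3 / δ = 3 * (1 / δ) := by ring
          rw [h3]
          linarith
  · intro k hk
    have : ν (Icc ((k : ℝ) * δ) (((k : ℝ) + 1) * δ)) = 0 := by
      refine measure_mono_null (t := (Icc (0:ℝ) 1)ᶜ) (fun x hx hxI => hk ?_) hν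
      rw [Finset.mem_Icc]
      constructor
      · have : (-1 : ℝ) ≤ k := by
          have h0 : 0 ≤ ((k : ℝ) + 1) * δ := hxI.1.trans hx.2
          have := nonneg_of_mul_nonneg_left h0 hδ
          linarith
        exact_mod_cast this
      · rw [Int.le_floor, le_div_iff₀ hδ]
        exact hx.1.trans hxI.2
    simp [this, pw]

/-- The `L^q`-spectrum, for `q ≥ 0`, of a probability measure on `[0,1]` is at most `1`. -/
lemma spectrum_le_one {ν : Measure ℝ} [IsProbabilityMeasure ν] (hν : ν (Icc (0:ℝ) 1)ᶜ = 0)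
    {q t : ℝ} (hq : 0 ≤ q)
    (ht : Tendsto (fun δ : ℝ => Real.log (Dq1 ν q δ) / (-Real.log δ)) (𝓝[>] (0:ℝ)) (𝓝 t)) :
    t ≤ 1 := by
  have hlim : Tendsto (fun δ : ℝ => Real.log 3 / (-Real.log δ) + 1) (𝓝[>] (0:ℝ)) (𝓝 (0 + 1)) :=
    ((tendsto_neg_atBot_atTop.comp Real.tendsto_log_nhdsGT_zero).const_div_atTop _).add_const 1
  rw [zero_add] at hlim
  refine le_of_tendsto_of_tendsto ht hlim ?_
  filter_upwards [Ioo_mem_nhdsGT (zero_lt_one' ℝ)] with δ hδ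
  have hneg : 0 < -Real.log δ := neg_pos.2 (Real.log_neg hδ.1 hδ.2)
  have hD0 : 0 ≤ Dq1 ν q δ := by
    refine tsum_nonneg fun k => ?_
    unfold pw
    split_ifs
    · exact le_rfl
    · exact Real.rpow_nonneg ENNReal.toReal_nonneg _
  have hle : Real.log (Dq1 ν q δ) ≤ Real.log 3 + -Real.log δ := by
    rcases hD0.eq_or_lt with h0 | h0
    · rw [← h0, Real.log_zero]
      have := Real.log_nonneg (by norm_num : (1:ℝ) ≤ 3)
      linarith
    · rw [← sub_eq_add_neg, ← Real.log_div (by norm_num) hδ.1.ne']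
      exact Real.log_le_log h0 (Dq1_le hν hq hδ.1 hδ.2.le)
  calc _ ≤ (Real.log 3 + -Real.log δ) / (-Real.log δ) := by gcongr
    _ = _ := by rw [add_div, div_self hneg.ne']

end ParabolicIFS

namespace PCarpetIFS

open ParabolicIFS

/-- The images of the open unit square under distinct words of equal length are disjoint. -/
lemma eq_of_wMap_eq {I : Type} [Fintype I] (S : PCarpetIFS I) : ∀ (u v : List I),
    u.length = v.length → ∀ x ∈ Ioo (0:ℝ) 1, ∀ y ∈ Ioo (0:ℝ) 1, ∀ x' ∈ Ioo (0:ℝ) 1,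
    ∀ y' ∈ Ioo (0:ℝ) 1, wMap S.f u x = wMap S.f v x' → wMap S.g u y = wMap S.g v y' → u = v := by
  have Mf := fun i => mapsTo_Ioo (S.mapsf i) (S.hasDerivf i) (S.nonzerof i)
  have Mg := fun i => mapsTo_Ioo (S.mapsg i) (S.hasDerivg i) (S.nonzerog i)
  intro u
  induction u with
  | nil =>
    intro v hl
    intros
    exact (List.length_eq_zero_iff.1 hl.symm).symm
  | cons a t ih =>
    intro v hl x hx y hy x' hx' y' hy' hf hg
    cases v with
    | nil => simp at hl
    | cons b r =>
      have h1 := wMap_mem Mf t hx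
      have h2 := wMap_mem Mg t hy
      have h3 := wMap_mem Mf r hx'
      have h4 := wMap_mem Mg r hy'
      simp only [wMap, Function.comp] at hf hg
      have hab : a = b := S.osc a b
        (Set.not_disjoint_iff.2 ⟨_, ⟨_, h1, rfl⟩, ⟨_, h3, hf.symm⟩⟩)
        (Set.not_disjoint_iff.2 ⟨_, ⟨_, h2, rfl⟩, ⟨_, h4, hg.symm⟩⟩)
      subst hab
      have hf' := injOn_Icc (S.hasDerivf a) (S.nonzerof a) (Ioo_subset_Icc_self h1)
        (Ioo_subset_Icc_self h3) hf
      have hg' := injOn_Icc (S.hasDerivg a) (S.nonzerog a) (Ioo_subset_Icc_self h2)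
        (Ioo_subset_Icc_self h4) hg
      rw [ih r (by simpa using hl) x hx y hy x' hx' y' hy' hf' hg']

/-- The total area of the rectangles of a given level is at most `1`. -/
lemma sum_area_le_one {I : Type} [Fintype I] (S : PCarpetIFS I) (n : ℕ) :
    ∑ w : Fin n → I, |wMap S.f (List.ofFn w) 1 - wMap S.f (List.ofFn w) 0| *
      |wMap S.g (List.ofFn w) 1 - wMap S.g (List.ofFn w) 0| ≤ 1 := by
  let J : (ℝ → ℝ) → Set ℝ := fun h => Ioo (min (h 0) (h 1)) (max (h 0) (h 1))
  let R : (Fin n → I) → Set (ℝ × ℝ) := fun w =>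
    J (wMap S.f (List.ofFn w)) ×ˢ J (wMap S.g (List.ofFn w))
  have Mf := fun i => mapsTo_Ioo (S.mapsf i) (S.hasDerivf i) (S.nonzerof i)
  have Mg := fun i => mapsTo_Ioo (S.mapsg i) (S.hasDerivg i) (S.nonzerog i)
  have Jf : ∀ w, J (wMap S.f w) ⊆ wMap S.f w '' Ioo (0:ℝ) 1 := fun w =>
    Ioo_min_max_subset_image fun x hx =>
      (wMap_hasDeriv S.mapsf S.hasDerivf w x hx).continuousWithinAt
  have Jg : ∀ w, J (wMap S.g w) ⊆ wMap S.g w '' Ioo (0:ℝ) 1 := fun w =>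
    Ioo_min_max_subset_image fun x hx =>
      (wMap_hasDeriv S.mapsg S.hasDerivg w x hx).continuousWithinAt
  have hvol : ∀ w, volume (R w) =
      ENNReal.ofReal (|wMap S.f (List.ofFn w) 1 - wMap S.f (List.ofFn w) 0| *
        |wMap S.g (List.ofFn w) 1 - wMap S.g (List.ofFn w) 0|) := by
    intro w
    rw [Measure.volume_eq_prod, Measure.prod_prod, Real.volume_Ioo, Real.volume_Ioo,
      max_sub_min_eq_abs, max_sub_min_eq_abs, ENNReal.ofReal_mul (abs_nonneg _)]
  have hdisj : Pairwise (Function.onFun Disjoint R) := by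
    intro u v huv
    refine Set.disjoint_left.2 fun p hu hv => huv (List.ofFn_injective ?_)
    obtain ⟨x, hx, hxe⟩ := Jf _ hu.1
    obtain ⟨y, hy, hye⟩ := Jg _ hu.2
    obtain ⟨x', hx', hxe'⟩ := Jf _ hv.1
    obtain ⟨y', hy', hye'⟩ := Jg _ hv.2
    exact S.eq_of_wMap_eq _ _ (by simp) x hx y hy x' hx' y' hy'
      (hxe.trans hxe'.symm) (hye.trans hye'.symm)
  have hsub : (⋃ w, R w) ⊆ Ioo (0:ℝ) 1 ×ˢ Ioo (0:ℝ) 1 := by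
    refine iUnion_subset fun w => Set.prod_mono ?_ ?_
    · exact (Jf _).trans (wMap_mem Mf _).image_subset
    · exact (Jg _).trans (wMap_mem Mg _).image_subset
  have hle : ∑ w, volume (R w) ≤ 1 := by
    rw [← tsum_fintype (L := .unconditional _), ← measure_iUnion hdisj
      fun w => measurableSet_Ioo.prod measurableSet_Ioo]
    refine (measure_mono hsub).trans ?_
    rw [Measure.volume_eq_prod, Measure.prod_prod]
    simp
  simp only [hvol] at hle
  rw [← ENNReal.ofReal_sum_of_nonneg fun w _ => by positivity] at hle
  exact ENNReal.ofReal_le_one.1 hle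

/-- If the suprema of `|f_w'|` and `|g_w'|` are at most `F` and `G`, then
`ᾱ₁(w)^t ᾱ₂(w)^{2-t} ≤ F G` for every `t ≤ 1`. -/
lemma a1U_rpow_mul_a2U_rpow_le {I : Type} [Fintype I] (S : PCarpetIFS I) (w : List I)
    {F G t : ℝ} (hF : ∀ x ∈ Icc (0:ℝ) 1, |wDeriv S.f S.f' w x| ≤ F)
    (hG : ∀ x ∈ Icc (0:ℝ) 1, |wDeriv S.g S.g' w x| ≤ G) (ht : t ≤ 1) :
    a1U S w ^ t * a2U S w ^ (2 - t) ≤ F * G := by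
  have hI : (0:ℝ) ∈ Icc (0:ℝ) 1 := ⟨le_rfl, zero_le_one⟩
  have : Nonempty (Icc (0:ℝ) 1) := ⟨⟨0, hI⟩⟩
  have hb1 : BddAbove (range fun x : Icc (0:ℝ) 1 =>
      max |wDeriv S.f S.f' w x| |wDeriv S.g S.g' w x|) :=
    ⟨max F G, by rintro _ ⟨x, rfl⟩; exact max_le_max (hF x x.2) (hG x x.2)⟩
  have hb2 : BddAbove (range fun x : Icc (0:ℝ) 1 =>
      min |wDeriv S.f S.f' w x| |wDeriv S.g S.g' w x|) :=
    ⟨min F G, by rintro _ ⟨x, rfl⟩; exact min_le_min (hF x x.2) (hG x x.2)⟩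
  have h1 : a1U S w ≤ max F G := ciSup_le fun x => max_le_max (hF x x.2) (hG x x.2)
  have h2 : a2U S w ≤ min F G := ciSup_le fun x => min_le_min (hF x x.2) (hG x x.2)
  have h21 : a2U S w ≤ a1U S w := ciSup_mono hb1 fun x => min_le_max
  have h0 : 0 < a2U S w := by
    refine lt_of_lt_of_le ?_ (le_ciSup hb2 ⟨0, hI⟩)
    exact lt_min (abs_pos.2 (wDeriv_ne_zero S.mapsf S.nonzerof w 0 hI))
      (abs_pos.2 (wDeriv_ne_zero S.mapsg S.nonzerog w 0 hI))
  have h01 : 0 < a1U S w := h0.trans_le h21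
  calc a1U S w ^ t * a2U S w ^ (2 - t)
      = a1U S w ^ t * (a2U S w ^ (1 - t) * a2U S w) := by
        rw [← Real.rpow_add_one h0.ne']
        ring_nf
    _ ≤ a1U S w ^ t * (a1U S w ^ (1 - t) * a2U S w) := by
        gcongr
    _ = a1U S w * a2U S w := by
        rw [← mul_assoc, ← Real.rpow_add h01]
        simp
    _ ≤ max F G * min F G := mul_le_mul h1 h2 h0.le (h01.le.trans h1)
    _ = F * G := max_mul_min F G

end PCarpetIFS

/-- For an almost quasi-Bernoulli measure on a parabolic carpet with the
summability conditions on the induced system, the carpet pressure satisfies `P(2, q) ≤ 1`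
for all `q ≥ 0`. -/
theorem carpet_pressure_at_two_le_one {I : Type} [Fintype I] [MeasurableSpace I]
    [MeasurableSingletonClass I]
    (S : PCarpetIFS I) (i0 : I)
    (hi0 : a1U S [i0] < 1)
    (hsumf : Summable fun φ : ↥((fun w : List I => wMap S.f w) '' Iinf i0) =>
      Metric.diam ((φ : ℝ → ℝ) '' Icc (0:ℝ) 1) ^ S.αf)
    (hsumg : Summable fun φ : ↥((fun w : List I => wMap S.g w) '' Iinf i0) =>
      Metric.diam ((φ : ℝ → ℝ) '' Icc (0:ℝ) 1) ^ S.αg)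
    (P : Measure (ℕ → I)) [IsProbabilityMeasure P]
    (hwqb : WeakQB P) (hqb : QBonInf P i0)
    (Pi : (ℕ → I) → ℝ × ℝ)
    (hPi : ∀ ω : ℕ → I,
      (⋂ n : ℕ, SMap S (List.ofFn fun k : Fin n => ω k) '' (Icc (0:ℝ) 1 ×ˢ Icc (0:ℝ) 1))
        = {Pi ω})
    (hPiM : Measurable Pi)
    (tf tg : ℝ → ℝ)
    (htf : ∀ q : ℝ, 0 ≤ q →
      Tendsto (fun δ : ℝ => Real.log (Dq1 (P.map fun ω => (Pi ω).1) q δ) / (-Real.log δ))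
        (𝓝[>] (0:ℝ)) (𝓝 (tf q)))
    (htg : ∀ q : ℝ, 0 ≤ q →
      Tendsto (fun δ : ℝ => Real.log (Dq1 (P.map fun ω => (Pi ω).2) q δ) / (-Real.log δ))
        (𝓝[>] (0:ℝ)) (𝓝 (tg q))) :
    ∀ q : ℝ, 0 ≤ q → ∀ L : ℝ,
      Tendsto (fun n : ℕ => cSum P S tf tg n 2 q ^ ((n : ℝ)⁻¹)) atTop (𝓝 L) → L ≤ 1 := by
  intro q hq L hL
  have hPi0 : ∀ ω, (Pi ω).1 ∈ Icc (0:ℝ) 1 ∧ (Pi ω).2 ∈ Icc (0:ℝ) 1 := by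
    intro ω
    have hmem : Pi ω ∈ ({Pi ω} : Set (ℝ × ℝ)) := rfl
    rw [← hPi ω] at hmem
    obtain ⟨p, hp, hpe⟩ := mem_iInter.1 hmem 0
    rw [← hpe]
    exact hp
  have m1 : Measurable fun ω => (Pi ω).1 := hPiM.fst
  have m2 : Measurable fun ω => (Pi ω).2 := hPiM.snd
  have := Measure.isProbabilityMeasure_map (μ := P) m1.aemeasurable
  have := Measure.isProbabilityMeasure_map (μ := P) m2.aemeasurable
  have htf1 : tf q ≤ 1 := by
    refine ParabolicIFS.spectrum_le_one ?_ hq (htf q hq)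
    rw [Measure.map_apply m1 measurableSet_Icc.compl]
    convert measure_empty (μ := P)
    exact eq_empty_of_forall_notMem fun ω hω => hω (hPi0 ω).1
  have htg1 : tg q ≤ 1 := by
    refine ParabolicIFS.spectrum_le_one ?_ hq (htg q hq)
    rw [Measure.map_apply m2 measurableSet_Icc.compl]
    convert measure_empty (μ := P)
    exact eq_empty_of_forall_notMem fun ω hω => hω (hPi0 ω).2
  have ht1 : ∀ w, tSel S tf tg w q ≤ 1 := by
    intro w
    unfold tSel
    split_ifs
    exacts [htf1, htg1]
  obtain ⟨Cf, -, hCf⟩ := S.holderf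
  obtain ⟨Cg, -, hCg⟩ := S.holderg
  have key : ∀ η : ℝ, 0 < η → L ≤ Real.exp (2 * η) := by
    intro η hη
    obtain ⟨K, hK, hKf⟩ := ParabolicIFS.exists_abs_wDeriv_le S.mapsf S.contractf S.hasDerivf
      (fun i => ParabolicIFS.continuousOn_of_abs_sub_le_rpow S.αf_pos (hCf i)) S.nonzerof hη
    obtain ⟨M, hM, hMg⟩ := ParabolicIFS.exists_abs_wDeriv_le S.mapsg S.contractg S.hasDerivg
      (fun i => ParabolicIFS.continuousOn_of_abs_sub_le_rpow S.αg_pos (hCg i)) S.nonzerog hη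
    have ha0 : ∀ w, 0 ≤ a1U S w := fun w =>
      Real.iSup_nonneg fun x => le_max_of_le_left (abs_nonneg _)
    have hb0 : ∀ w, 0 ≤ a2U S w := fun w =>
      Real.iSup_nonneg fun x => le_min (abs_nonneg _) (abs_nonneg _)
    have hc0 : ∀ n, 0 ≤ cSum P S tf tg n 2 q := fun n => Finset.sum_nonneg fun w _ =>
      mul_nonneg (mul_nonneg (Real.rpow_nonneg ENNReal.toReal_nonneg _)
        (Real.rpow_nonneg (ha0 _) _)) (Real.rpow_nonneg (hb0 _) _)
    have hsum : ∀ n : ℕ, cSum P S tf tg n 2 q ≤ K * M * Real.exp (2 * η) ^ n := by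
      intro n
      calc cSum P S tf tg n 2 q
          ≤ ∑ w : Fin n → I, K * M * Real.exp (2 * η) ^ n *
            (|wMap S.f (List.ofFn w) 1 - wMap S.f (List.ofFn w) 0| *
              |wMap S.g (List.ofFn w) 1 - wMap S.g (List.ofFn w) 0|) := by
            refine Finset.sum_le_sum fun w _ => ?_
            have hp : (P (cyl (List.ofFn w))).toReal ^ q ≤ 1 :=
              Real.rpow_le_one ENNReal.toReal_nonneg
                (ENNReal.toReal_le_of_le_ofReal zero_le_one (by simpa using prob_le_one)) hq
            have hprod := S.a1U_rpow_mul_a2U_rpow_le (List.ofFn w) (hKf _) (hMg _)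
              (ht1 (List.ofFn w))
            rw [mul_assoc]
            refine (mul_le_of_le_one_left (mul_nonneg (Real.rpow_nonneg (ha0 _) _)
              (Real.rpow_nonneg (hb0 _) _)) hp).trans (hprod.trans_eq ?_)
            have he : Real.exp (2 * η) ^ n = Real.exp (η * n) * Real.exp (η * n) := by
              rw [← Real.exp_nat_mul, ← Real.exp_add]
              ring_nf
            rw [he, List.length_ofFn]
            ring
        _ ≤ K * M * Real.exp (2 * η) ^ n * 1 := by
            rw [← Finset.mul_sum]
            exact mul_le_mul_of_nonneg_left (S.sum_area_le_one n) (by positivity)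
        _ = _ := mul_one _
    have hlim : Tendsto (fun n : ℕ => (K * M) ^ ((n : ℝ)⁻¹) * Real.exp (2 * η)) atTop
        (𝓝 ((K * M) ^ (0:ℝ) * Real.exp (2 * η))) :=
      ((Real.continuousAt_const_rpow (by positivity)).tendsto.comp
        tendsto_inv_atTop_nhds_zero_nat).mul_const _
    rw [Real.rpow_zero, one_mul] at hlim
    refine le_of_tendsto_of_tendsto hL hlim ?_
    filter_upwards [eventually_ge_atTop 1] with n hn
    calc cSum P S tf tg n 2 q ^ ((n : ℝ)⁻¹)
        ≤ (K * M * Real.exp (2 * η) ^ n) ^ ((n : ℝ)⁻¹) :=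
          Real.rpow_le_rpow (hc0 n) (hsum n) (by positivity)
      _ = _ := by
          rw [Real.mul_rpow (by positivity) (by positivity),
            Real.pow_rpow_inv_natCast (Real.exp_pos _).le (by omega)]
  have hexp : Tendsto (fun η : ℝ => Real.exp (2 * η)) (𝓝[>] 0) (𝓝 1) := by
    have : Continuous fun η : ℝ => Real.exp (2 * η) := by fun_prop
    simpa using this.continuousWithinAt (x := 0) (s := Ioi 0) |>.tendsto
  exact ge_of_tendsto hexp (by filter_upwards [self_mem_nhdsWithin] with η hη using key η hη)
end
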